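/- arXiv:2005.02896 — 2 statements merged into one kernel-verified Lean document; each statement's English description precedes it below -/
import Mathlib

section
/- There exists a real number α ≥ 1 such that every finite simple hole-with-hat-free graph is α-narrow. -/
open Finset

namespace EHhat

variable {V : Type*}

/-- `c : ZMod n → V` describes a hole (induced cycle of length `n ≥ 4`) in `G`. -/
def IsHole (G : SimpleGraph V) (n : ℕ) (c : ZMod n → V) : Prop :=
  4 ≤ n ∧ Function.Injective c ∧
    ∀ i j : ZMod n, G.Adj (c i) (c j) ↔ (i - j = 1 ∨ j - i = 1)

/-- `G` contains a hole together with a hat: a vertex outside the hole with exactly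
two neighbours on the hole, and these two neighbours are adjacent (consecutive). -/
def HasHoleWithHat (G : SimpleGraph V) : Prop :=
  ∃ (n : ℕ) (c : ZMod n → V) (v : V) (i : ZMod n),
    IsHole G n c ∧ (∀ j, v ≠ c j) ∧ (∀ j, G.Adj v (c j) ↔ (j = i ∨ j = i + 1))

def HoleWithHatFree (G : SimpleGraph V) : Prop := ¬ HasHoleWithHat G

/-- A graph is perfect if chromatic number equals clique number for
every induced subgraph. -/
def IsPerfect [Fintype V] (G : SimpleGraph V) : Prop :=
  ∀ S : Finset V,
    (G.induce (S : Set V)).chromaticNumber = ((G.induce (S : Set V)).cliqueNum : ℕ∞)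

/-- `f` is a good function on `G`: it is nonnegative and sums to at most 1 on
every perfect induced subgraph of `G`. -/
def GoodOn [Fintype V] (G : SimpleGraph V) (f : V → ℝ) : Prop :=
  (∀ v, 0 ≤ f v) ∧
  ∀ S : Finset V, IsPerfect (G.induce (S : Set V)) → ∑ v ∈ S, f v ≤ 1

/-- `G` is `α`-narrow if `∑ v, f v ^ α ≤ 1` for every good function `f` on `G`. -/
def Narrow [Fintype V] (G : SimpleGraph V) (α : ℝ) : Prop :=
  ∀ f : V → ℝ, GoodOn G f → ∑ v, f v ^ α ≤ 1

/-- `(G, f)` is an `α`-critical pair. -/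
def Critical [Fintype V] (G : SimpleGraph V) (f : V → ℝ) (α : ℝ) : Prop :=
  GoodOn G f ∧
  (∀ S : Finset V, S ≠ Finset.univ → Narrow (G.induce (S : Set V)) α) ∧
  1 < ∑ v, f v ^ α

/-- `A` is complete to `B`. -/
def CompleteTo (G : SimpleGraph V) (A B : Set V) : Prop :=
  ∀ a ∈ A, ∀ b ∈ B, G.Adj a b

/-- `A` is anticomplete to `B`. -/
def AnticompleteTo (G : SimpleGraph V) (A B : Set V) : Prop :=
  ∀ a ∈ A, ∀ b ∈ B, ¬ G.Adj a b

/-- The vertex `v` is complete to the set `C`. -/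
def VertCompleteTo (G : SimpleGraph V) (v : V) (C : Set V) : Prop :=
  ∀ c ∈ C, G.Adj v c

/-- The vertex `v` is mixed on `C`: it has both a neighbour and a non-neighbour in `C`. -/
def MixedOn (G : SimpleGraph V) (v : V) (C : Set V) : Prop :=
  (∃ c ∈ C, G.Adj v c) ∧ (∃ c ∈ C, ¬ G.Adj v c)

/-- `X ⊆ V(G)` is connected: `G[X]` is a connected graph. -/
def ConnSet (G : SimpleGraph V) (X : Set V) : Prop :=
  (G.induce X).Connected

/-- `X ⊆ V(G)` is anticonnected: the complement of `G[X]` is a connected graph. -/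
def AnticonnSet (G : SimpleGraph V) (X : Set V) : Prop :=
  ((G.induce X)ᶜ).Connected

/-- The sum of `f` over a set `X` of vertices. -/
noncomputable def setSum [Fintype V] (f : V → ℝ) (X : Set V) : ℝ :=
  ∑ v, X.indicator f v

/-- `w` is a weight function making `(G, w)` a weighted graph. -/
def IsWeight [Fintype V] (w : V → ℝ) : Prop :=
  (∀ v, 0 ≤ w v) ∧ ∑ v, w v = 1

/-- The weighted graph `(G, w)` is `ε`-coherent. -/
def Coherent [Fintype V] (G : SimpleGraph V) (w : V → ℝ) (ε : ℝ) : Prop :=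
  (∀ v, w v < ε) ∧
  (∀ v, setSum w (G.neighborSet v) < ε) ∧
  ∀ A B : Set V, Disjoint A B → AnticompleteTo G A B →
    min (setSum w A) (setSum w B) < ε

/-- `Y` is (the vertex set of) a component of `G[X]`: a maximal connected subset of `X`. -/
def IsCompOf (G : SimpleGraph V) (X Y : Set V) : Prop :=
  Y ⊆ X ∧ ConnSet G Y ∧
  ∀ Z : Set V, Y ⊆ Z → Z ⊆ X → ConnSet G Z → Z = Y

/-- `Y` is the big component of `G[X]` (with respect to the weight `w` and `ε`). -/
def IsBigComp [Fintype V] (G : SimpleGraph V) (w : V → ℝ) (ε : ℝ) (X Y : Set V) : Prop :=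
  IsCompOf G X Y ∧ setSum w X - ε < setSum w Y

/-- `v` is an attachment of `A`: a vertex outside `A` with a neighbour in `A`. -/
def IsAttachment (G : SimpleGraph V) (A : Set V) (v : V) : Prop :=
  v ∉ A ∧ ∃ a ∈ A, G.Adj v a

/-- `(C, D)` is a split of the weighted graph `(G, w)`. -/
def IsSplit [Fintype V] (G : SimpleGraph V) (w : V → ℝ) (ε : ℝ) (C D : Set V) : Prop :=
  Disjoint C D ∧ 2 ≤ C.ncard ∧ ConnSet G C ∧ AnticonnSet G C ∧
  D.Nonempty ∧ D = {v | v ∉ C ∧ ∀ c ∈ C, G.Adj v c} ∧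
  ∀ Y : Set V, IsBigComp G w ε ((C ∪ D)ᶜ) Y → ∀ c ∈ C, ¬ IsAttachment G Y c

/-- A split is optimal if its first part is maximal among splits. -/
def IsOptimalSplit [Fintype V] (G : SimpleGraph V) (w : V → ℝ) (ε : ℝ) (C D : Set V) : Prop :=
  IsSplit G w ε C D ∧ ∀ C' D' : Set V, IsSplit G w ε C' D' → C ⊆ C' → C' = C

/-- `(A, C, D, B)` is a fracture of `(G, w)`: `(C, D)` is an optimal split, `A` is the union
of the components of `G \ (C ∪ D)` with an attachment in `C`, and `B` is the rest. -/
def IsFracture [Fintype V] (G : SimpleGraph V) (w : V → ℝ) (ε : ℝ)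
    (A C D B : Set V) : Prop :=
  IsOptimalSplit G w ε C D ∧
  A = {v | ∃ Y : Set V, IsCompOf G ((C ∪ D)ᶜ) Y ∧ v ∈ Y ∧ ∃ c ∈ C, IsAttachment G Y c} ∧
  B = ((C ∪ D)ᶜ : Set V) \ A

/-- The generating relation for the forcer graph: vertices `0,1,2,3` and `4,5,6,7`
each induce a path, and the two quadruples are complete to each other. -/
def forcerRel (i j : Fin 8) : Prop :=
  (i.val < 4 ∧ 4 ≤ j.val) ∨ j.val = i.val + 1

/-- The forcer graph. -/
def forcer : SimpleGraph (Fin 8) := SimpleGraph.fromRel forcerRel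

def ForcerFree (G : SimpleGraph V) : Prop := IsEmpty (forcer ↪g G)

/-- Given an embedded copy of the forcer via the vertex map `f`, one of its two
constituent paths has all its vertices in `S`. -/
def ConstituentPathIn (f : Fin 8 → V) (S : Set V) : Prop :=
  (∀ i : Fin 8, i.val < 4 → f i ∈ S) ∨ (∀ i : Fin 8, 4 ≤ i.val → f i ∈ S)

/-- `X` is a homogeneous set of `H`. -/
def IsHomogeneousSet {W : Type*} (H : SimpleGraph W) (X : Set W) : Prop :=
  ∀ v ∉ X, (∀ x ∈ X, H.Adj v x) ∨ (∀ x ∈ X, ¬ H.Adj v x)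

/-- `H` is guarded: for each forcer in `H` there is a proper homogeneous set
containing a constituent path of the forcer. -/
def Guarded {W : Type*} (H : SimpleGraph W) : Prop :=
  ∀ f : forcer ↪g H, ∃ X : Set W,
    X ≠ Set.univ ∧ IsHomogeneousSet H X ∧ ConstituentPathIn (fun i => f i) X

/-- The house: the complement of the five-vertex path. -/
def house : SimpleGraph (Fin 5) := (SimpleGraph.pathGraph 5)ᶜ

def HouseFree (G : SimpleGraph V) : Prop := IsEmpty (house ↪g G)

/-- `g` is a good function on the induced subgraph `G[X]`. -/
def GoodOnSub [Fintype V] (G : SimpleGraph V) (X : Set V) (g : V → ℝ) : Prop :=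
  (∀ v ∈ X, 0 ≤ g v) ∧
  ∀ S : Finset V, (S : Set V) ⊆ X → IsPerfect (G.induce (S : Set V)) →
    ∑ v ∈ S, g v ≤ 1

section Connectivity

open scoped Classical

/-- A nonempty set of vertices with no proper nonempty subset closed under adjacency. -/
def Conn (G : SimpleGraph V) (X : Finset V) : Prop :=
  X.Nonempty ∧ ∀ Y ⊆ X, Y.Nonempty → (∀ y ∈ Y, ∀ x ∈ X, G.Adj y x → x ∈ Y) → X ⊆ Y

variable {G : SimpleGraph V}

lemma conn_singleton (v : V) : Conn G {v} := by
  refine ⟨singleton_nonempty v, fun Y hY hne _ => ?_⟩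
  rw [Finset.subset_singleton_iff] at hY
  rcases hY with rfl | rfl
  · simp at hne
  · rfl

lemma Conn.exists_adj {X : Finset V} (hX : Conn G X) {p : V → Prop}
    (hp : ∃ x ∈ X, p x) (hn : ∃ x ∈ X, ¬ p x) :
    ∃ a ∈ X, ∃ b ∈ X, p a ∧ ¬ p b ∧ G.Adj a b := by
  by_contra! h
  obtain ⟨x, hx, hpx⟩ := hp
  obtain ⟨y, hy, hpy⟩ := hn
  have := hX.2 (X.filter p) (filter_subset _ _) ⟨x, by simp [hx, hpx]⟩ (by
    intro a ha b hb hab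
    simp only [mem_filter] at ha ⊢
    exact ⟨hb, by_contra fun hpb => h a ha.1 b hb ha.2 hpb hab⟩)
  exact hpy (mem_filter.1 (this hy)).2

lemma conn_of_exists_adj {X : Finset V} (hne : X.Nonempty)
    (h : ∀ p : V → Prop, (∃ x ∈ X, p x) → (∃ x ∈ X, ¬ p x) →
      ∃ a ∈ X, ∃ b ∈ X, p a ∧ ¬ p b ∧ G.Adj a b) : Conn G X := by
  refine ⟨hne, fun Y hY ⟨y, hy⟩ hcl x hx => by_contra fun hxY => ?_⟩
  obtain ⟨a, -, b, hb, ha, hbY, hab⟩ := h (· ∈ Y) ⟨y, hY hy, hy⟩ ⟨x, hx, hxY⟩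
  exact hbY (hcl a ha b hb hab)

lemma Conn.insert {X : Finset V} (hX : Conn G X) {a x : V} (hx : x ∈ X) (h : G.Adj a x) :
    Conn G (insert a X) := by
  refine conn_of_exists_adj (insert_nonempty _ _) fun p hp hn => ?_
  by_cases h1 : (∃ x ∈ X, p x) ∧ ∃ x ∈ X, ¬ p x
  · obtain ⟨u, hu, w, hw, h'⟩ := hX.exists_adj h1.1 h1.2
    exact ⟨u, mem_insert_of_mem hu, w, mem_insert_of_mem hw, h'⟩
  · have hax := h.symm
    simp only [mem_insert, exists_eq_or_imp] at hp hn
    by_cases hpx : p x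
    · have : ¬ p a := by
        rcases hn with hn | hn
        · exact hn
        · exact absurd ⟨⟨x, hx, hpx⟩, hn⟩ h1
      exact ⟨x, mem_insert_of_mem hx, a, mem_insert_self _ _, hpx, this, hax⟩
    · have : p a := by
        rcases hp with hp | hp
        · exact hp
        · exact absurd ⟨hp, ⟨x, hx, hpx⟩⟩ h1
      exact ⟨a, mem_insert_self _ _, x, mem_insert_of_mem hx, this, hpx, h⟩

/-- `U` is a component of the subgraph induced on `Y`. -/
def IsComp (G : SimpleGraph V) (Y U : Finset V) : Prop :=
  U ⊆ Y ∧ Conn G U ∧ ∀ u ∈ U, ∀ y ∈ Y, G.Adj u y → y ∈ U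

lemma IsComp.subset_of_conn {Y U D : Finset V} (hU : IsComp G Y U) (hD : Conn G D)
    (hDY : D ⊆ Y) (h : ∃ z ∈ D, z ∈ U) : D ⊆ U := by
  intro d hd
  by_contra hdU
  obtain ⟨a, -, b, hb, ha, hbU, hab⟩ := hD.exists_adj (p := (· ∈ U)) h ⟨d, hd, hdU⟩
  exact hbU (hU.2.2 a ha b (hDY hb) hab)

lemma exists_isComp {Y : Finset V} {z : V} (hz : z ∈ Y) : ∃ U, IsComp G Y U ∧ z ∈ U := by
  have hfin : (Y.powerset.filter fun U => Conn G U ∧ z ∈ U).Nonempty :=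
    ⟨{z}, by simp [hz, conn_singleton]⟩
  obtain ⟨U, hU, hmax⟩ := exists_max_image _ Finset.card hfin
  simp only [mem_filter, mem_powerset] at hU hmax
  refine ⟨U, ⟨hU.1, hU.2.1, fun u hu y hy huy => by_contra fun hyU => ?_⟩, hU.2.2⟩
  have := hmax (insert y U) ⟨insert_subset hy hU.1, hU.2.1.insert hu huy.symm,
    mem_insert_of_mem hU.2.2⟩
  rw [card_insert_of_notMem hyU] at this
  omega

lemma exists_isComp_of_conn {Y D : Finset V} (hD : Conn G D) (hDY : D ⊆ Y) :
    ∃ U, IsComp G Y U ∧ D ⊆ U := by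
  obtain ⟨z, hz⟩ := hD.1
  obtain ⟨U, hU, hzU⟩ := exists_isComp (G := G) (hDY hz)
  exact ⟨U, hU, hU.subset_of_conn hD hDY ⟨z, hz, hzU⟩⟩

/-- Moving one step from `c` towards `z` inside a connected set. -/
lemma Conn.exists_step {W : Finset V} (hW : Conn G W) {c z : V}
    (hc : ∃ w ∈ W, G.Adj c w) (hz : z ∈ W) (hcz : ¬ G.Adj c z) :
    ∃ U ⊆ W, ∃ d ∈ W, Conn G U ∧ z ∈ U ∧ G.Adj c d ∧ (∀ u ∈ U, ¬ G.Adj c u) ∧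
      (∃ u ∈ U, G.Adj d u) ∧ U.card < W.card := by
  obtain ⟨w, hw, hcw⟩ := hc
  obtain ⟨U, ⟨hUW, hU, hcl⟩, hzU⟩ :=
    exists_isComp (G := G) (Y := W.filter fun u => ¬ G.Adj c u) (z := z) (by simp [hz, hcz])
  have hcU : ∀ u ∈ U, ¬ G.Adj c u := fun u hu => (mem_filter.1 (hUW hu)).2
  have hUW' : U ⊆ W := hUW.trans (filter_subset _ _)
  obtain ⟨a, haW, d, hd, ha, hdU, had⟩ :=
    hW.exists_adj (p := (· ∈ U)) ⟨z, hz, hzU⟩ ⟨w, hw, fun h => hcU w h hcw⟩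
  have hcd : G.Adj c d := by
    by_contra h
    exact hdU (hcl a ha d (by simp [hd, h]) had)
  exact ⟨U, hUW', d, hd, hU, hzU, hcd, hcU, ⟨a, ha, had.symm⟩,
    card_lt_card ⟨hUW', fun h => hdU (h hd)⟩⟩

/-- A shortest path inside `W` from the neighbourhood of `c` to the set `t`. -/
lemma Conn.exists_induced_path {t : V → Prop} {W : Finset V} (hW : Conn G W) {c : V}
    (hc : ∃ w ∈ W, G.Adj c w) (ht : ∃ w ∈ W, t w) :
    ∃ (n : ℕ) (p : ℕ → V), (∀ i ≤ n, p i ∈ W) ∧ (∀ i ≤ n, G.Adj c (p i) ↔ i = 0) ∧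
      (∀ i ≤ n, t (p i) ↔ i = n) ∧ (∀ i ≤ n, ∀ j ≤ n, p i = p j → i = j) ∧
      ∀ i ≤ n, ∀ j ≤ n, G.Adj (p i) (p j) ↔ (i = j + 1 ∨ j = i + 1) := by
  induction hk : W.card using Nat.strong_induction_on generalizing W c with
  | _ k ih =>
  by_cases h : ∃ w ∈ W, G.Adj c w ∧ t w
  · obtain ⟨w, hw, hcw, htw⟩ := h
    refine ⟨0, fun _ => w, ?_, ?_, ?_, ?_, ?_⟩
    all_goals intro i hi
    all_goals obtain rfl : i = 0 := by omega
    · exact hw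
    · simpa using hcw
    · simpa using htw
    · intro j hj _
      omega
    · intro j hj
      obtain rfl : j = 0 := by omega
      simp
  · push Not at h
    obtain ⟨z, hz, htz⟩ := ht
    obtain ⟨U, hUW, d, hd, hU, hzU, hcd, hcU, hdU, hlt⟩ :=
      hW.exists_step hc hz (fun hcz => h z hz hcz htz)
    obtain ⟨n, p, h1, h2, h3, h4, h5⟩ := ih U.card (hk ▸ hlt) hU hdU ⟨z, hzU, htz⟩ rfl
    have hdp : ∀ i ≤ n, d ≠ p i := fun i hi e => hcU _ (h1 i hi) (e ▸ hcd)
    refine ⟨n + 1, fun i => if i = 0 then d else p (i - 1), ?_, ?_, ?_, ?_, ?_⟩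
    · intro i hi
      rcases i with _ | i
      · simpa using hd
      · simpa using hUW (h1 i (by omega))
    · intro i hi
      rcases i with _ | i
      · simpa using hcd
      · simpa using hcU _ (h1 i (by omega))
    · intro i hi
      rcases i with _ | i
      · simpa using h d hd hcd
      · simpa using h3 i (by omega)
    · intro i hi j hj e
      rcases i with _ | i <;> rcases j with _ | j
      · rfl
      · exact absurd (by simpa using e) (hdp j (by omega))
      · exact absurd (by simpa using e.symm) (hdp i (by omega))
      · have := h4 i (by omega) j (by omega) (by simpa using e)
        omega
    · intro i hi j hj
      rcases i with _ | i <;> rcases j with _ | j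
      · simp
      · simpa using h2 j (by omega)
      · simpa [G.adj_comm] using h2 i (by omega)
      · simpa using h5 i (by omega) j (by omega)

lemma zmod_sub_eq_one_iff {n : ℕ} [NeZero n] (hn : 2 ≤ n) (i j : ZMod n) :
    i - j = 1 ↔ (i.val = j.val + 1 ∨ (i.val = 0 ∧ j.val = n - 1)) := by
  have hi := ZMod.val_lt i
  have hj := ZMod.val_lt j
  have h1 : (1 : ZMod n).val = 1 := ZMod.val_one'' (by omega)
  rw [sub_eq_iff_eq_add, ← (ZMod.val_injective n).eq_iff, ZMod.val_add, h1]
  rcases (show j.val + 1 < n ∨ j.val + 1 = n by omega) with h | h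
  · rw [add_comm 1, Nat.mod_eq_of_lt h]
    omega
  · rw [add_comm 1, h, Nat.mod_self]
    omega

/-- A triangle `h, c, d` together with a connected set avoiding the neighbourhood of `h` and
containing neighbours of `c` and of `d`, but no common neighbour, yields a hole with a hat. -/
lemma hasHoleWithHat_of_triangle {h c d : V} {W : Finset V} (hhc : G.Adj h c)
    (hhd : G.Adj h d) (hcd : G.Adj c d) (hW : Conn G W) (hh : ∀ w ∈ W, w ≠ h ∧ ¬ G.Adj h w)
    (hcW : ∃ w ∈ W, G.Adj c w) (hdW : ∃ w ∈ W, G.Adj d w)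
    (hno : ∀ w ∈ W, G.Adj c w → ¬ G.Adj d w) : HasHoleWithHat G := by
  obtain ⟨n, p, h1, h2, h3, h4, h5⟩ := hW.exists_induced_path (t := G.Adj d) hcW hdW
  have hn : n ≠ 0 := by
    rintro rfl
    exact hno _ (h1 0 le_rfl) ((h2 0 le_rfl).2 rfl) ((h3 0 le_rfl).2 rfl)
  have hcp : ∀ i ≤ n, p i ≠ c := fun i hi e => (hh _ (h1 i hi)).2 (e ▸ hhc)
  have hdp : ∀ i ≤ n, p i ≠ d := fun i hi e => (hh _ (h1 i hi)).2 (e ▸ hhd)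
  let q : ℕ → V := fun i => if i = 0 then c else if i = n + 2 then d else p (i - 1)
  have q0 : q 0 = c := rfl
  have qn : q (n + 2) = d := by simp [q]
  have qs : ∀ i ≤ n, q (i + 1) = p i := by
    intro i hi
    have : i + 1 ≠ n + 2 := by omega
    simp [q]
    omega
  have cases3 : ∀ i < n + 3, i = 0 ∨ i = n + 2 ∨ ∃ j ≤ n, i = j + 1 := by
    intro i hi
    rcases i with _ | i
    · simp
    · by_cases hi' : i = n + 1
      · exact Or.inr (Or.inl (by omega))
      · exact Or.inr (Or.inr ⟨i, by omega, rfl⟩)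
  have hinj : ∀ i < n + 3, ∀ j < n + 3, q i = q j → i = j := by
    intro i hi j hj e
    rcases cases3 i hi with rfl | rfl | ⟨i, li, rfl⟩ <;>
      rcases cases3 j hj with rfl | rfl | ⟨j, lj, rfl⟩
    · rfl
    · rw [q0, qn] at e
      exact absurd e hcd.ne
    · rw [q0, qs j lj] at e
      exact absurd e.symm (hcp j lj)
    · rw [q0, qn] at e
      exact absurd e.symm hcd.ne
    · rfl
    · rw [qn, qs j lj] at e
      exact absurd e.symm (hdp j lj)
    · rw [q0, qs i li] at e
      exact absurd e (hcp i li)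
    · rw [qn, qs i li] at e
      exact absurd e (hdp i li)
    · rw [qs i li, qs j lj] at e
      rw [h4 i li j lj e]
  have hadj : ∀ i < n + 3, ∀ j < n + 3, G.Adj (q i) (q j) ↔
      ((i = j + 1 ∨ (i = 0 ∧ j = n + 3 - 1)) ∨ (j = i + 1 ∨ (j = 0 ∧ i = n + 3 - 1))) := by
    intro i hi j hj
    rcases cases3 i hi with rfl | rfl | ⟨i, li, rfl⟩ <;>
      rcases cases3 j hj with rfl | rfl | ⟨j, lj, rfl⟩
    · simp
    · rw [q0, qn]
      simp [hcd]
    · rw [q0, qs j lj, h2 j lj]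
      omega
    · rw [q0, qn]
      simp [hcd.symm]
    · simp
    · rw [qn, qs j lj, h3 j lj]
      omega
    · rw [q0, qs i li, G.adj_comm, h2 i li]
      omega
    · rw [qn, qs i li, G.adj_comm, h3 i li]
      omega
    · rw [qs i li, qs j lj, h5 i li j lj]
      omega
  have : NeZero (n + 3) := ⟨by omega⟩
  have hval : ∀ i : ZMod (n + 3), i.val < n + 3 := fun i => ZMod.val_lt i
  have hm1 : ((-1 : ZMod (n + 3))).val = n + 2 := ZMod.val_neg_one (n + 2)
  refine ⟨n + 3, fun i => q i.val, h, -1, ⟨by omega, ?_, ?_⟩, ?_, ?_⟩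
  · intro i j e
    exact ZMod.val_injective _ (hinj _ (hval i) _ (hval j) e)
  · intro i j
    rw [zmod_sub_eq_one_iff (by omega), zmod_sub_eq_one_iff (by omega)]
    exact hadj _ (hval i) _ (hval j)
  · intro j e
    simp only at e
    rcases cases3 _ (hval j) with hj | hj | ⟨i, hi, hj⟩
    · rw [hj, q0] at e
      exact hhc.ne e
    · rw [hj, qn] at e
      exact hhd.ne e
    · rw [hj, qs i hi] at e
      exact (hh _ (h1 i hi)).1 e.symm
  · intro j
    rw [neg_add_cancel, ← (ZMod.val_injective _).eq_iff (a := j) (b := -1), hm1,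
      ← ZMod.val_eq_zero]
    simp only
    rcases cases3 _ (hval j) with hj | hj | ⟨i, hi, hj⟩
    · simp [hj, q0, hhc]
    · simp [hj, qn, hhd]
    · rw [hj, qs i hi]
      have := (hh _ (h1 i hi)).2
      constructor
      · intro h
        exact absurd h this
      · omega

lemma IsComp.of_sdiff {Y U Q : Finset V} (hU : IsComp G Y U) (hQ : IsComp G (Y \ U) Q) :
    IsComp G Y Q := by
  refine ⟨hQ.1.trans sdiff_subset, hQ.2.1, fun q hq y hy h => hQ.2.2 q hq y ?_ h⟩
  exact mem_sdiff.2 ⟨hy, fun hyU => (mem_sdiff.1 (hQ.1 hq)).2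
    (hU.2.2 y hyU q (mem_sdiff.1 (hQ.1 hq)).1 h.symm)⟩

/-- The complement of an induced five-vertex path contains a hole with a hat. -/
lemma hasHoleWithHat_of_house {a b c d e : V} (hac : G.Adj a c) (had : G.Adj a d)
    (hae : G.Adj a e) (hbd : G.Adj b d) (hbe : G.Adj b e) (hce : G.Adj c e)
    (hab : ¬ G.Adj a b) (hbc : b ≠ c ∧ ¬ G.Adj b c) (hcd : c ≠ d ∧ ¬ G.Adj c d)
    (hde : ¬ G.Adj d e) : HasHoleWithHat G := by
  refine hasHoleWithHat_of_triangle hac.symm hce hae (W := {d, b})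
    ((conn_singleton b).insert (by simp) hbd.symm) ?_ ⟨d, by simp, had⟩ ⟨b, by simp, hbe.symm⟩ ?_
  · intro x hx
    simp only [mem_insert, mem_singleton] at hx
    rcases hx with rfl | rfl
    · exact ⟨hcd.1.symm, hcd.2⟩
    · exact ⟨hbc.1, fun h => hbc.2 h.symm⟩
  · intro x hx hax
    simp only [mem_insert, mem_singleton] at hx
    rcases hx with rfl | rfl
    · exact fun h => hde h.symm
    · exact absurd hax hab

/-- Propagation along a connected set: in a graph with no hole with a hat, if two vertices `x, y`
have the same neighbours in the neighbourhood of each of their common neighbours in `W`, then they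
have the same neighbours in `W`. -/
lemma adj_iff_of_propagation (hG : ¬ HasHoleWithHat G) {x y : V} {W : Finset V}
    (hW : Conn G W) {h d : V} (hhd : G.Adj h d) (hhx : G.Adj h x) (hhy : G.Adj h y)
    (hdx : G.Adj d x) (hdy : G.Adj d y)
    (hh : ∀ w ∈ W, w ≠ h ∧ ¬ G.Adj h w) (hdW : ∃ w ∈ W, G.Adj d w)
    (hstep : ∀ m, (m ∈ W ∨ m = d) → G.Adj m x → G.Adj m y → ∀ w ∈ W, G.Adj m w →
      (G.Adj w x ↔ G.Adj w y)) :
    ∀ z ∈ W, G.Adj z x ↔ G.Adj z y := by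
  induction hk : W.card using Nat.strong_induction_on generalizing W h d with
  | _ k ih =>
  intro z hz
  by_cases hdz : G.Adj d z
  · exact hstep d (Or.inr rfl) hdx hdy z hz hdz
  obtain ⟨U, hUW, e, he, hU, hzU, hde, hdU, heU, hlt⟩ := hW.exists_step hdW hz hdz
  have hiff := hstep d (Or.inr rfl) hdx hdy e he hde
  by_cases hex : G.Adj e x
  · have hne : ∀ w ∈ U, w ≠ d := by
      rintro w hw rfl
      exact (hh w (hUW hw)).2 hhd
    refine ih U.card (hk ▸ hlt) hU hde hdx hdy hex (hiff.1 hex)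
      (fun w hw => ⟨hne w hw, hdU w hw⟩) heU ?_ rfl z hzU
    intro m hm hmx hmy w hw hmw
    refine hstep m (Or.inl ?_) hmx hmy w (hUW hw) hmw
    rcases hm with hm | rfl
    · exact hUW hm
    · exact he
  · have hey : ¬ G.Adj e y := fun h => hex (hiff.2 h)
    obtain ⟨u, hu, heu⟩ := heU
    have key : ∀ c, G.Adj h c → G.Adj d c → ¬ G.Adj e c → ¬ G.Adj z c := by
      intro c hhc hdc hec hzc
      refine hG (hasHoleWithHat_of_triangle hhc hhd hdc.symm (hU.insert hu heu) ?_
        ⟨z, by simp [hzU], hzc.symm⟩ ⟨e, by simp, hde⟩ ?_)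
      · intro w hw
        rcases mem_insert.1 hw with rfl | hw
        · exact hh w he
        · exact hh w (hUW hw)
      · intro w hw hcw
        rcases mem_insert.1 hw with rfl | hw
        · exact absurd hcw.symm hec
        · exact hdU w hw
    exact iff_of_false (key x hhx hdx hex) (key y hhy hdy hey)

end Connectivity

section Separator

open scoped Classical

variable {G : SimpleGraph V}

/-- A notion of largeness for vertex sets: any two large sets meet, and the removal of the closed
neighbourhoods of any three vertices leaves a large connected set. -/
structure IsHaven (G : SimpleGraph V) (big : Finset V → Prop) : Prop where
  inter : ∀ X Y, big X → big Y → ∃ z ∈ X, z ∈ Y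
  mono : ∀ X Y, X ⊆ Y → big X → big Y
  exists_conn : ∀ a b c : V, ∃ D, Conn G D ∧ big D ∧
    ∀ z ∈ D, (z ≠ a ∧ ¬ G.Adj a z) ∧ (z ≠ b ∧ ¬ G.Adj b z) ∧ (z ≠ c ∧ ¬ G.Adj c z)

lemma IsHaven.exists_isComp {big : Finset V → Prop} (hb : IsHaven G big) (a b c : V)
    {Y : Finset V}
    (hY : ∀ z, (z ≠ a ∧ ¬ G.Adj a z) → (z ≠ b ∧ ¬ G.Adj b z) → (z ≠ c ∧ ¬ G.Adj c z) → z ∈ Y) :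
    ∃ K, IsComp G Y K ∧ big K := by
  obtain ⟨D, hD, hbD, h⟩ := hb.exists_conn a b c
  obtain ⟨K, hK, hDK⟩ := exists_isComp_of_conn (Y := Y) hD
    (fun z hz => hY z (h z hz).1 (h z hz).2.1 (h z hz).2.2)
  exact ⟨K, hK, hb.mono _ _ hDK hbD⟩

variable [Fintype V]

/-- The vertices outside `K` with a neighbour in `K`. -/
noncomputable def boundary (G : SimpleGraph V) (K : Finset V) : Finset V :=
  univ.filter fun v => v ∉ K ∧ ∃ k ∈ K, G.Adj v k

lemma mem_boundary {K : Finset V} {v : V} :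
    v ∈ boundary G K ↔ v ∉ K ∧ ∃ k ∈ K, G.Adj v k := by
  simp [boundary]

/-- `K` is a large connected set, anticomplete to `A`, whose boundary is complete to `A`. -/
structure IsBlock (G : SimpleGraph V) (big : Finset V → Prop) (A K : Finset V) : Prop where
  nonempty : A.Nonempty
  conn : Conn G K
  big : big K
  anti : ∀ a ∈ A, ∀ k ∈ K, k ≠ a ∧ ¬ G.Adj a k
  complete : ∀ a ∈ A, ∀ s ∈ boundary G K, G.Adj a s

/-- Inside a large connected set `K` with boundary complete to `v`, a large component remains after
removing the neighbourhoods of two further vertices outside `K`. -/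
lemma IsBlock.exists_isComp {big : Finset V → Prop} (hb : IsHaven G big) {v : V}
    {K : Finset V} (hK : IsBlock G big {v} K) {x y : V} :
    ∃ E, IsComp G (K.filter fun z => ¬ G.Adj x z ∧ ¬ G.Adj y z) E ∧ big E := by
  obtain ⟨D, hD, hbD, h⟩ := hb.exists_conn v x y
  obtain ⟨z, hzD, hzK⟩ := hb.inter D K hbD hK.big
  have hDK : D ⊆ K := by
    intro d hd
    by_contra hdK
    obtain ⟨a, -, b, hbD, ha, hbK, hab⟩ :=
      hD.exists_adj (p := (· ∈ K)) ⟨z, hzD, hzK⟩ ⟨d, hd, hdK⟩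
    exact (h b hbD).1.2 (hK.complete v (by simp) b (mem_boundary.2 ⟨hbK, a, ha, hab.symm⟩))
  obtain ⟨E, hE, hDE⟩ := exists_isComp_of_conn (G := G)
    (Y := K.filter fun z => ¬ G.Adj x z ∧ ¬ G.Adj y z) hD
    (fun z hz => mem_filter.2 ⟨hDK hz, (h z hz).2.1.2, (h z hz).2.2.2⟩)
  exact ⟨E, hE, hb.mono _ _ hDE hbD⟩

/-- The structure around a vertex `v` whose large component `K` is minimal: `S` is the boundary of
`K`, and `C x` is the large component left in `K` by `x`. -/
lemma comp_eq_of_adj (hG : ¬ HasHoleWithHat G) {big : Finset V → Prop} (hb : IsHaven G big)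
    {v : V} {K : Finset V} (hK : IsBlock G big {v} K) {C : V → Finset V}
    (hC : ∀ x ∈ boundary G K, IsComp G (K.filter fun z => ¬ G.Adj x z) (C x) ∧ big (C x))
    (hY : ∀ x ∈ boundary G K, ∃ y ∈ boundary G K, ¬ G.Adj x y ∧ ∃ k ∈ C x, G.Adj y k)
    {x x' : V} (hx : x ∈ boundary G K) (hx' : x' ∈ boundary G K) (hxx : G.Adj x x') :
    C x = C x' := by
  have hvS : ∀ {s}, s ∈ boundary G K → G.Adj v s := fun hs => hK.complete v (by simp) _ hs
  have hvK : ∀ k ∈ K, k ≠ v ∧ ¬ G.Adj v k := hK.anti v (by simp)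
  have hCK : ∀ {s}, s ∈ boundary G K → C s ⊆ K := fun hs => (hC _ hs).1.1.trans (filter_subset _ _)
  have hCn : ∀ {s}, s ∈ boundary G K → ∀ k ∈ C s, ¬ G.Adj s k :=
    fun hs k hk => (mem_filter.1 ((hC _ hs).1.1 hk)).2
  -- it suffices to exclude a strict inclusion
  have main : ∀ {x x' : V}, x ∈ boundary G K → x' ∈ boundary G K → G.Adj x x' →
      C x ⊆ C x' → C x' ⊆ C x := by
    intro x x' hx hx' hxx hsub
    by_contra hns
    have hne : ∃ k ∈ C x', k ∉ C x := by
      simpa [Finset.subset_iff] using hns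
    -- the boundary of `C x` inside `C x'`
    obtain ⟨k0, hk0⟩ := (hC x hx).1.2.1.1
    obtain ⟨t, ht, s, hs, htx, hsx, hts⟩ := (hC x' hx').1.2.1.exists_adj (p := (· ∈ C x))
      ⟨k0, hsub hk0, hk0⟩ hne
    have hxs : G.Adj x s := by
      by_contra h
      exact hsx ((hC x hx).1.2.2 t htx s (by simp [hCK hx' hs, h]) hts)
    obtain ⟨y, hy, hxy, k1, hk1, hyk1⟩ := hY x hx
    have hyx' : G.Adj x' y := by
      by_contra hyx'
      have hyK := (mem_boundary.1 hy).1
      refine hG (hasHoleWithHat_of_triangle (hvS hx').symm hxx.symm (hvS hx)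
        (W := insert y (insert s (C x))) (((hC x hx).1.2.1.insert htx hts.symm).insert
          (mem_insert_of_mem hk1) hyk1) ?_ ⟨y, by simp, hvS hy⟩ ⟨s, by simp, hxs⟩ ?_)
      · intro w hw
        rcases mem_insert.1 hw with rfl | hw
        · exact ⟨fun h => hxy (h ▸ hxx), hyx'⟩
        · have hw' : w ∈ C x' := by
            rcases mem_insert.1 hw with rfl | hw
            · exact hs
            · exact hsub hw
          exact ⟨fun h => (mem_boundary.1 hx').1 (h ▸ hCK hx' hw'), hCn hx' w hw'⟩
      · intro w hw hvw
        rcases mem_insert.1 hw with rfl | hw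
        · exact hxy
        · refine absurd hvw (hvK w ?_).2
          rcases mem_insert.1 hw with rfl | hw
          · exact hCK hx' hs
          · exact hCK hx hw
    -- a neighbour of `x'` attached to `C x'`
    obtain ⟨-, k2, hk2, hx'k2⟩ := mem_boundary.1 hx'
    obtain ⟨q, hq, p, hp, hqC, hpC, hqp⟩ := hK.conn.exists_adj (p := (· ∈ C x'))
      ⟨k0, hCK hx hk0, hsub hk0⟩ ⟨k2, hk2, fun h => hCn hx' _ h hx'k2⟩
    have hx'p : G.Adj x' p := by
      by_contra h
      exact hpC ((hC x' hx').1.2.2 q hqC p (by simp [hp, h]) hqp)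
    have hadjp : ∀ z ∈ boundary G K, G.Adj x' z → (∃ k ∈ C x', G.Adj z k) → G.Adj p z := by
      intro z hz hx'z hzk
      by_contra hpz
      obtain ⟨k, hk, hzk⟩ := hzk
      refine hG (hasHoleWithHat_of_triangle (hvS hz) (hvS hx') hx'z.symm
        (W := insert p (C x')) ((hC x' hx').1.2.1.insert hqC hqp.symm) ?_
        ⟨k, by simp [hk], hzk⟩ ⟨p, by simp, hx'p⟩ ?_)
      · intro w hw
        rcases mem_insert.1 hw with rfl | hw
        · exact hvK w hp
        · exact hvK w (hCK hx' hw)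
      · intro w hw hzw
        rcases mem_insert.1 hw with rfl | hw
        · exact absurd hzw.symm hpz
        · exact hCn hx' w hw
    have hpx : G.Adj p x := hadjp x hx hxx.symm ⟨s, hs, hxs⟩
    have hpy : G.Adj p y := hadjp y hy hyx' ⟨k1, hsub hk1, hyk1⟩
    have hyx : x ≠ y := by
      rintro rfl
      exact hCn hx k1 hk1 hyk1
    have hfour : ∀ {x y : V}, x ∈ boundary G K → y ∈ boundary G K → ¬ G.Adj x y → x ≠ y →
        ∀ m ∈ K, G.Adj m x → G.Adj m y → ∀ w ∈ K, G.Adj m w → G.Adj w x → G.Adj w y := by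
      intro x y hx hy hxy hne m hm hmx hmy w hw hmw hwx
      by_contra hwy
      have hyv : Conn G {y, v} := (conn_singleton v).insert (by simp) (hvS hy).symm
      refine hG (hasHoleWithHat_of_triangle hwx hmw.symm hmx.symm hyv ?_
        ⟨v, by simp, (hvS hx).symm⟩ ⟨y, by simp, hmy⟩ ?_)
      · intro u hu
        rcases mem_insert.1 hu with rfl | hu
        · exact ⟨fun h => (mem_boundary.1 hy).1 (h ▸ hw), hwy⟩
        · rw [mem_singleton] at hu
          subst hu
          exact ⟨(hvK w hw).1.symm, fun h => (hvK w hw).2 h.symm⟩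
      · intro u hu hxu
        rcases mem_insert.1 hu with rfl | hu
        · exact absurd hxu hxy
        · rw [mem_singleton] at hu
          subst hu
          exact fun h => (hvK m hm).2 h.symm
    have hprop := adj_iff_of_propagation hG (x := x) (y := y) (hC x' hx').1.2.1 hx'p hxx.symm
      hyx' hpx hpy
      (fun w hw => ⟨fun h => (mem_boundary.1 hx').1 (h ▸ hCK hx' hw), hCn hx' w hw⟩)
      ⟨q, hqC, hqp.symm⟩ (by
        intro m hm hmx hmy w hw hmw
        have hmK : m ∈ K := by
          rcases hm with hm | rfl
          · exact hCK hx' hm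
          · exact hp
        exact ⟨hfour hx hy hxy hyx m hmK hmx hmy w (hCK hx' hw) hmw,
          hfour hy hx (fun h => hxy h.symm) hyx.symm m hmK hmy hmx w (hCK hx' hw) hmw⟩)
    exact hCn hx k1 hk1 ((hprop k1 (hsub hk1)).2 hyk1.symm).symm
  -- comparability
  obtain ⟨E, hE, hbE⟩ := hK.exists_isComp hb (x := x) (y := x')
  have hEm : ∀ e ∈ E, e ∈ K ∧ ¬ G.Adj x e ∧ ¬ G.Adj x' e := fun e he => by
    simpa using hE.1 he
  have hsubC : ∀ z ∈ boundary G K, (∀ e ∈ E, ¬ G.Adj z e) → E ⊆ C z := by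
    intro z hz hze
    obtain ⟨w, hw, hw'⟩ := hb.inter E (C z) hbE (hC z hz).2
    exact (hC z hz).1.subset_of_conn hE.2.1
      (fun e he => mem_filter.2 ⟨(hEm e he).1, hze e he⟩) ⟨w, hw, hw'⟩
  have hEx := hsubC x hx fun e he => (hEm e he).2.1
  have hEx' := hsubC x' hx' fun e he => (hEm e he).2.2
  have hcomp : C x ⊆ E ∨ C x' ⊆ E := by
    by_contra! hcon
    obtain ⟨e0, he0⟩ := hE.2.1.1
    have hatt : ∀ {x x' : V}, x ∈ boundary G K → (∀ e ∈ E, ¬ G.Adj x e) → E ⊆ C x →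
        ¬ C x ⊆ E → (∀ u ∈ E, ∀ y ∈ K, ¬ G.Adj x y → ¬ G.Adj x' y → G.Adj u y → y ∈ E) →
        ∃ a ∈ K, ¬ G.Adj x a ∧ G.Adj x' a ∧ ∃ e ∈ E, G.Adj a e := by
      intro x x' hx hxE hEx hns hcl
      obtain ⟨w, hw, hwE⟩ := Finset.not_subset.1 hns
      obtain ⟨e, he, a, ha, heE, haE, hea⟩ := (hC x hx).1.2.1.exists_adj (p := (· ∈ E))
        ⟨e0, hEx he0, he0⟩ ⟨w, hw, hwE⟩
      refine ⟨a, hCK hx ha, hCn hx a ha, ?_, e, heE, hea.symm⟩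
      by_contra h
      exact haE (hcl e heE a (hCK hx ha) (hCn hx a ha) h hea)
    obtain ⟨a, haK, hxa, hx'a, e, he, hae⟩ := hatt (x' := x') hx (fun e he => (hEm e he).2.1) hEx
      hcon.1 (fun u hu y hy h1 h2 huy => hE.2.2 u hu y (by simp [hy, h1, h2]) huy)
    obtain ⟨b, hbK, hx'b, hxb, e', he', hbe⟩ := hatt (x' := x) hx' (fun e he => (hEm e he).2.2) hEx'
      hcon.2 (fun u hu y hy h1 h2 huy => hE.2.2 u hu y (by simp [hy, h1, h2]) huy)
    refine hG (hasHoleWithHat_of_triangle (hvS hx) (hvS hx') hxx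
      (W := insert a (insert b E)) ((hE.2.1.insert he' hbe).insert (mem_insert_of_mem he) hae) ?_
      ⟨b, by simp, hxb⟩ ⟨a, by simp, hx'a⟩ ?_)
    · intro w hw
      refine hvK w ?_
      simp only [mem_insert] at hw
      rcases hw with rfl | rfl | hw
      · exact haK
      · exact hbK
      · exact (hEm w hw).1
    · intro w hw hxw
      simp only [mem_insert] at hw
      rcases hw with rfl | rfl | hw
      · exact absurd hxw hxa
      · exact hx'b
      · exact (hEm w hw).2.2
  rcases hcomp with h | h
  · have := h.trans hEx'
    exact this.antisymm (main hx hx' hxx this)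
  · have := h.trans hEx
    exact (main hx' hx hxx.symm this).antisymm this

/-- Every component of the boundary forms a block with some large connected set. -/
lemma exists_isBlock_of_component (hG : ¬ HasHoleWithHat G) {big : Finset V → Prop}
    (hb : IsHaven G big) {v : V} {K : Finset V} (hK : IsBlock G big {v} K) {C : V → Finset V}
    (hC : ∀ x ∈ boundary G K, IsComp G (K.filter fun z => ¬ G.Adj x z) (C x) ∧ big (C x))
    (hY : ∀ x ∈ boundary G K, ∃ y ∈ boundary G K, ¬ G.Adj x y ∧ ∃ k ∈ C x, G.Adj y k)
    {Q : Finset V} (hQ : IsComp G (boundary G K) Q) : ∃ K', IsBlock G big Q K' := by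
  have hvS : ∀ {s}, s ∈ boundary G K → G.Adj v s := fun hs => hK.complete v (by simp) _ hs
  have hvK : ∀ k ∈ K, k ≠ v ∧ ¬ G.Adj v k := hK.anti v (by simp)
  have hCK : ∀ {s}, s ∈ boundary G K → C s ⊆ K := fun hs => (hC _ hs).1.1.trans (filter_subset _ _)
  have hCn : ∀ {s}, s ∈ boundary G K → ∀ k ∈ C s, ¬ G.Adj s k :=
    fun hs k hk => (mem_filter.1 ((hC _ hs).1.1 hk)).2
  obtain ⟨q0, hq0⟩ := hQ.2.1.1
  have hconst : ∀ q ∈ Q, C q = C q0 := by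
    by_contra! h
    obtain ⟨a, ha, b, hb', h1, h2, hab⟩ := hQ.2.1.exists_adj (p := fun q => C q = C q0)
      ⟨q0, hq0, rfl⟩ h
    exact h2 ((comp_eq_of_adj hG hb hK hC hY (hQ.1 ha) (hQ.1 hb') hab).symm.trans h1)
  have hCQ : ∀ q ∈ Q, ∀ k ∈ C q0, ¬ G.Adj q k := fun q hq k hk =>
    hCn (hQ.1 hq) k (by rwa [hconst q hq])
  have hQK : ∀ q ∈ Q, q ∉ K := fun q hq => (mem_boundary.1 (hQ.1 hq)).1
  obtain ⟨K', hK', hsub⟩ := exists_isComp_of_conn (G := G)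
    (Y := univ.filter fun z => z ∉ Q ∧ ∀ q ∈ Q, ¬ G.Adj q z) (hC q0 (hQ.1 hq0)).1.2.1 (by
      intro z hz
      simp only [mem_filter, mem_univ, true_and]
      exact ⟨fun h => hQK z h (hCK (hQ.1 hq0) hz), fun q hq => hCQ q hq z hz⟩)
  have hK'm : ∀ z ∈ K', z ∉ Q ∧ ∀ q ∈ Q, ¬ G.Adj q z := fun z hz => by
    simpa using hK'.1 hz
  refine ⟨K', ⟨q0, hq0⟩, hK'.2.1, hb.mono _ _ hsub (hC q0 (hQ.1 hq0)).2, ?_, ?_⟩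
  · intro a ha k hk
    exact ⟨fun h => (hK'm k hk).1 (h ▸ ha), (hK'm k hk).2 a ha⟩
  intro a ha u hu
  obtain ⟨huK', k, hk, huk⟩ := mem_boundary.1 hu
  have huQ : u ∉ Q := fun h => (hK'm k hk).2 u h huk
  have hex : ∃ q ∈ Q, G.Adj u q := by
    by_contra! h
    exact huK' (hK'.2.2 k hk u (by simpa [huQ] using fun q hq hqu => h q hq hqu.symm) huk.symm)
  by_contra hau
  obtain ⟨q, hq, q', hq', huq, huq', hqq'⟩ := hQ.2.1.exists_adj (p := fun q => G.Adj u q) hex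
    ⟨a, ha, fun h => hau h.symm⟩
  have huS : u ∉ boundary G K := fun h => huQ (hQ.2.2 q hq u h huq.symm)
  have hW : Conn G (insert u K') := hK'.2.1.insert hk huk
  have hat : ∀ w ∈ insert u K', w ≠ q' ∧ ¬ G.Adj q' w := by
    intro w hw
    rcases mem_insert.1 hw with rfl | hw
    · exact ⟨fun h => huQ (h ▸ hq'), fun h => huq' h.symm⟩
    · exact ⟨fun h => (hK'm w hw).1 (h ▸ hq'), (hK'm w hw).2 q' hq'⟩
  have key : ∀ d, G.Adj q d → G.Adj q' d → ¬ G.Adj u d → ¬ ∃ k ∈ K', G.Adj d k := by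
    rintro d hqd hq'd hud ⟨k, hk, hdk⟩
    refine hG (hasHoleWithHat_of_triangle hqq'.symm hq'd hqd hW hat ⟨u, by simp, huq.symm⟩
      ⟨k, by simp [hk], hdk⟩ ?_)
    intro w hw hqw
    rcases mem_insert.1 hw with rfl | hw
    · exact fun h => hud h.symm
    · exact absurd hqw ((hK'm w hw).2 q hq)
  by_cases huv : G.Adj u v
  · have huK : u ∉ K := fun h => (hvK u h).2 huv.symm
    have hunK : ∀ k ∈ K, ¬ G.Adj u k := fun k hk h => huS (mem_boundary.2 ⟨huK, k, hk, h⟩)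
    obtain ⟨-, k2, hk2, hqk2⟩ := mem_boundary.1 (hQ.1 hq)
    obtain ⟨k0, hk0⟩ := (hC q0 (hQ.1 hq0)).1.2.1.1
    obtain ⟨t, -, b, hbK, ht, hbC, htb⟩ := hK.conn.exists_adj (p := (· ∈ C q0))
      ⟨k0, hCK (hQ.1 hq0) hk0, hk0⟩ ⟨k2, hk2, fun h => hCQ q hq k2 h hqk2⟩
    have hbQ : ∀ q ∈ Q, G.Adj q b := by
      intro q hq
      by_contra h
      have := (hC q (hQ.1 hq)).1.2.2 t (by rwa [hconst q hq]) b (by simp [hbK, h]) htb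
      exact hbC (by rwa [hconst q hq] at this)
    exact key b (hbQ q hq) (hbQ q' hq') (hunK b hbK) ⟨t, hsub ht, htb.symm⟩
  · obtain ⟨y, hy, hqy, k1, hk1, hyk1⟩ := hY q (hQ.1 hq)
    rw [hconst q hq] at hk1
    have hyQ : y ∉ Q := fun h => hCQ y h k1 hk1 hyk1
    have hyK' : y ∈ K' := by
      refine hK'.2.2 k1 (hsub hk1) y ?_ hyk1.symm
      simp only [mem_filter, mem_univ, true_and]
      exact ⟨hyQ, fun q hq h => hyQ (hQ.2.2 q hq y hy h)⟩
    exact key v (hvS (hQ.1 hq)).symm (hvS (hQ.1 hq')).symm huv ⟨y, hyK', hvS hy⟩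

/-- Given a block `A`, some large connected set separates `A` from its boundary in such a way that
every component of that boundary is again a block. -/
theorem exists_separator (hG : ¬ HasHoleWithHat G) {big : Finset V → Prop}
    (hb : IsHaven G big) {A K₀ : Finset V} (hA : IsBlock G big A K₀) :
    ∃ K, Conn G K ∧ big K ∧ (∀ a ∈ A, a ∉ K ∧ a ∉ boundary G K) ∧
      ∀ Q, IsComp G (boundary G K) Q → ∃ K', IsBlock G big Q K' := by
  obtain ⟨v₀, hv₀⟩ := hA.nonempty
  have hfin : (univ.filter fun K => (∃ v, IsBlock G big {v} K) ∧
      ∀ a ∈ A, a ∉ K ∧ a ∉ boundary G K).Nonempty := by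
    refine ⟨K₀, ?_⟩
    simp only [mem_filter, mem_univ, true_and]
    refine ⟨⟨v₀, by simp, hA.conn, hA.big, ?_, ?_⟩, fun a ha => ⟨fun h => (hA.anti a ha a h).1 rfl,
      fun h => G.irrefl (hA.complete a ha a h)⟩⟩
    · intro a ha
      rw [mem_singleton] at ha
      exact ha ▸ hA.anti v₀ hv₀
    · intro a ha
      rw [mem_singleton] at ha
      exact ha ▸ hA.complete v₀ hv₀
  obtain ⟨K, hKm, hmin⟩ := exists_min_image _ Finset.card hfin
  simp only [mem_filter, mem_univ, true_and] at hKm hmin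
  obtain ⟨⟨v, hK⟩, hAK⟩ := hKm
  have hvS : ∀ {s}, s ∈ boundary G K → G.Adj v s := fun hs => hK.complete v (by simp) _ hs
  have hexC : ∀ x, ∃ E, IsComp G (K.filter fun z => ¬ G.Adj x z) E ∧ big E := by
    intro x
    simpa using hK.exists_isComp hb (x := x) (y := x)
  choose C hC using hexC
  refine ⟨K, hK.conn, hK.big, hAK, fun Q hQ =>
    exists_isBlock_of_component hG hb hK (fun x _ => hC x) ?_ hQ⟩
  intro x hx
  obtain ⟨hxK, k, hk, hxk⟩ := mem_boundary.1 hx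
  have hCK : C x ⊆ K := (hC x).1.1.trans (filter_subset _ _)
  have hCn : ∀ k ∈ C x, ¬ G.Adj x k := fun k hk => (mem_filter.1 ((hC x).1.1 hk)).2
  have hbd : ∀ y ∈ boundary G (C x), y ∈ K ∧ G.Adj x y ∨ y ∈ boundary G K := by
    intro y hy
    obtain ⟨hyC, c, hc, hyc⟩ := mem_boundary.1 hy
    by_cases hyK : y ∈ K
    · refine Or.inl ⟨hyK, by_contra fun h => hyC ?_⟩
      exact (hC x).1.2.2 c hc y (by simp [hyK, h]) hyc.symm
    · exact Or.inr (mem_boundary.2 ⟨hyK, c, hCK hc, hyc⟩)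
  by_contra! hcon
  have hlt : (C x).card < K.card := card_lt_card ⟨hCK, fun h => hCn k (h hk) hxk⟩
  refine absurd (hmin (C x) ⟨⟨x, by simp, (hC x).1.2.1, (hC x).2, ?_, ?_⟩, ?_⟩) (by omega)
  · intro a ha k hk
    rw [mem_singleton] at ha
    subst ha
    exact ⟨fun h => hxK (h ▸ hCK hk), hCn k hk⟩
  · intro a ha y hy
    rw [mem_singleton] at ha
    subst ha
    rcases hbd y hy with h | h
    · exact h.2
    · by_contra hxy
      obtain ⟨-, c, hc, hyc⟩ := mem_boundary.1 hy
      exact hcon y h hxy c hc hyc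
  · intro a ha
    refine ⟨fun h => (hAK a ha).1 (hCK h), fun h => ?_⟩
    rcases hbd a h with h | h
    · exact (hAK a ha).1 h.1
    · exact (hAK a ha).2 h

/-- A graph with a haven contains an induced path on five vertices. -/
theorem IsHaven.exists_path [Nonempty V] {big : Finset V → Prop} (hb : IsHaven G big) :
    ∃ a b c d e : V, G.Adj a b ∧ G.Adj b c ∧ G.Adj c d ∧ G.Adj d e ∧
      (a ≠ c ∧ ¬ G.Adj a c) ∧ (a ≠ d ∧ ¬ G.Adj a d) ∧ (a ≠ e ∧ ¬ G.Adj a e) ∧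
      (b ≠ d ∧ ¬ G.Adj b d) ∧ (b ≠ e ∧ ¬ G.Adj b e) ∧ (c ≠ e ∧ ¬ G.Adj c e) := by
  obtain ⟨r⟩ := ‹Nonempty V›
  obtain ⟨C₀, hC₀, hbC₀⟩ := hb.exists_isComp r r r (Y := univ) (by simp)
  obtain ⟨a, haC⟩ := hC₀.2.1.1
  have next : ∀ (a b c u : V) (Z C : Finset V), IsComp G Z C → big C →
      (∃ n ∈ C, n = u ∨ G.Adj u n) → (u = a ∨ u = b ∨ u = c) →
      (∀ z, (z ≠ a ∧ ¬ G.Adj a z) → (z ≠ b ∧ ¬ G.Adj b z) → (z ≠ c ∧ ¬ G.Adj c z) → z ∈ Z) →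
      ∃ D, IsComp G (Z.filter fun z => z ≠ u ∧ ¬ G.Adj u z) D ∧ big D ∧
        ∃ w ∈ C, G.Adj u w ∧ ∃ d ∈ D, G.Adj w d := by
    intro a b c u Z C hC hbC ⟨n, hn, hnu⟩ huabc hZ
    obtain ⟨D, hD, hbD⟩ := hb.exists_isComp a b c
      (Y := Z.filter fun z => z ≠ u ∧ ¬ G.Adj u z) (by
        intro z h1 h2 h3
        refine mem_filter.2 ⟨hZ z h1 h2 h3, ?_⟩
        rcases huabc with rfl | rfl | rfl <;> assumption)
    obtain ⟨z, hzD, hzC⟩ := hb.inter D C hbD hbC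
    have hDC : D ⊆ C := hC.subset_of_conn hD.2.1 (hD.1.trans (filter_subset _ _)) ⟨z, hzD, hzC⟩
    have huD : n ∉ D := fun h => hnu.elim (mem_filter.1 (hD.1 h)).2.1 (mem_filter.1 (hD.1 h)).2.2
    obtain ⟨d, -, w, hw, hd, hwD, hdw⟩ := hC.2.1.exists_adj (p := (· ∈ D)) ⟨z, hzC, hzD⟩
      ⟨n, hn, huD⟩
    refine ⟨D, hD, hbD, w, hw, ?_, d, hd, hdw.symm⟩
    by_contra h
    have hwu : w ≠ u := by
      rintro rfl
      exact (mem_filter.1 (hD.1 hd)).2.2 hdw.symm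
    exact hwD (hD.2.2 d hd w (mem_filter.2 ⟨hC.1 hw, hwu, h⟩) hdw)
  obtain ⟨C₁, hC₁, hbC₁, b, -, hab, n, hn, hbn⟩ := next a a a a univ C₀ hC₀ hbC₀
    ⟨a, haC, Or.inl rfl⟩ (Or.inl rfl) (by simp)
  obtain ⟨C₂, hC₂, hbC₂, c, hcC, hbc, n', hn', hcn⟩ := next a b b b _ C₁ hC₁ hbC₁
    ⟨n, hn, Or.inr hbn⟩ (Or.inr (Or.inl rfl)) (by simp +contextual)
  obtain ⟨C₃, hC₃, -, d, hdC, hcd, e, heC, hde⟩ := next a b c c _ C₂ hC₂ hbC₂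
    ⟨n', hn', Or.inr hcn⟩ (Or.inr (Or.inr rfl)) (by simp +contextual)
  have hc := hC₁.1 hcC
  have hd := hC₂.1 hdC
  have he := hC₃.1 heC
  simp only [mem_filter, mem_univ, true_and] at hc hd he
  exact ⟨a, b, c, d, e, hab, hbc, hcd, hde, ⟨hc.1.symm, hc.2⟩, ⟨hd.1.1.symm, hd.1.2⟩,
    ⟨he.1.1.1.symm, he.1.1.2⟩, ⟨hd.2.1.symm, hd.2.2⟩, ⟨he.1.2.1.symm, he.1.2.2⟩,
    ⟨he.2.1.symm, he.2.2⟩⟩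

end Separator

section Measure

open scoped Classical

variable [Fintype V] {G : SimpleGraph V}

/-- A probability measure `w` on the vertices, bounded by the cube of a monotone set function `g`
that is superadditive on anticomplete pairs, and giving little weight to every closed
neighbourhood. -/
structure Controlled (G : SimpleGraph V) (w : V → ℝ) (g : Finset V → ℝ) : Prop where
  nonneg : ∀ v, 0 ≤ w v
  sum_eq : ∑ v, w v = 1
  g_nonneg : ∀ X, 0 ≤ g X
  g_mono : ∀ X Y, X ⊆ Y → g X ≤ g Y
  g_univ : g univ ≤ 1
  g_add : ∀ A B, Disjoint A B → (∀ a ∈ A, ∀ b ∈ B, ¬ G.Adj a b) → g A + g B ≤ g (A ∪ B)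
  le_cube : ∀ X, ∑ v ∈ X, w v ≤ g X ^ 3
  nbhd : ∀ v, ∑ z with z = v ∨ G.Adj v z, w z ≤ 1 / 10

variable {w : V → ℝ} {g : Finset V → ℝ}

lemma Controlled.sum_mono (h : Controlled G w g) {X Y : Finset V} (hXY : X ⊆ Y) :
    ∑ v ∈ X, w v ≤ ∑ v ∈ Y, w v :=
  sum_le_sum_of_subset_of_nonneg hXY fun v _ _ => h.nonneg v

lemma Controlled.g_comp (h : Controlled G w g) {X U : Finset V} (hU : IsComp G X U) :
    g U + g (X \ U) ≤ g X := by
  have := h.g_add U (X \ U) disjoint_sdiff fun a ha b hb hab =>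
    (mem_sdiff.1 hb).2 (hU.2.2 a ha b (mem_sdiff.1 hb).1 hab)
  rwa [union_sdiff_of_subset hU.1] at this

lemma Controlled.sum_le_of_comp (h : Controlled G w g) {κ : ℝ} (hκ : 0 ≤ κ) (X : Finset V)
    (hX : ∀ U, IsComp G X U → ∑ v ∈ U, w v ≤ κ * g U) : ∑ v ∈ X, w v ≤ κ * g X := by
  induction X using Finset.strongInduction with
  | _ X ih =>
  rcases X.eq_empty_or_nonempty with rfl | ⟨x, hx⟩
  · simpa using mul_nonneg hκ (h.g_nonneg _)
  obtain ⟨U, hU, -⟩ := exists_isComp_of_conn (G := G) (Y := X) (conn_singleton x)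
    (by simpa using hx)
  have hss : X \ U ⊂ X := by
    obtain ⟨u, hu⟩ := hU.2.1.1
    exact ⟨sdiff_subset, fun hh => (mem_sdiff.1 (hh (hU.1 hu))).2 hu⟩
  have h1 := ih _ hss fun Q hQ => hX Q (hU.of_sdiff hQ)
  have h2 := hX U hU
  have h3 := sum_sdiff (f := w) hU.1
  nlinarith [h.g_comp hU]

lemma Controlled.g_le_one (h : Controlled G w g) (X : Finset V) : g X ≤ 1 :=
  (h.g_mono _ _ (subset_univ X)).trans h.g_univ

lemma Controlled.isHaven (h : Controlled G w g) :
    IsHaven G fun X => 1 / 2 < ∑ v ∈ X, w v := by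
  refine ⟨fun X Y hX hY => ?_, fun X Y hXY hX => hX.trans_le (h.sum_mono hXY), fun a b c => ?_⟩
  · by_contra! hd
    have h1 := h.sum_mono (subset_univ (X ∪ Y))
    rw [sum_union (disjoint_left.2 hd), h.sum_eq] at h1
    linarith
  set X : Finset V := univ.filter fun z =>
    (z ≠ a ∧ ¬ G.Adj a z) ∧ (z ≠ b ∧ ¬ G.Adj b z) ∧ (z ≠ c ∧ ¬ G.Adj c z) with hX
  have hXm : ∀ z ∈ X, (z ≠ a ∧ ¬ G.Adj a z) ∧ (z ≠ b ∧ ¬ G.Adj b z) ∧ (z ≠ c ∧ ¬ G.Adj c z) :=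
    fun z hz => by simpa [hX] using hz
  have hbig : 7 / 10 ≤ ∑ v ∈ X, w v := by
    have h1 : ∑ v, w v ≤ ∑ v ∈ X, w v + (∑ z with z = a ∨ G.Adj a z, w z +
        (∑ z with z = b ∨ G.Adj b z, w z + ∑ z with z = c ∨ G.Adj c z, w z)) := by
      simp only [hX, sum_filter, ← sum_add_distrib]
      refine sum_le_sum fun z _ => ?_
      have := h.nonneg z
      by_cases hA : z = a ∨ G.Adj a z <;> by_cases hB : z = b ∨ G.Adj b z <;>
        by_cases hC : z = c ∨ G.Adj c z <;> simp only [hA, hB, hC, if_true, if_false]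
      all_goals
        split_ifs with hn
        all_goals first
          | linarith
          | exact absurd ⟨not_or.1 hA, not_or.1 hB, not_or.1 hC⟩ hn
    linarith [h.sum_eq, h.nbhd a, h.nbhd b, h.nbhd c]
  by_cases hex : ∃ U, IsComp G X U ∧ 1 / 2 < g U
  · obtain ⟨U, hU, hgU⟩ := hex
    refine ⟨U, hU.2.1, ?_, fun z hz => hXm z (hU.1 hz)⟩
    have h1 := sum_sdiff (f := w) hU.1
    have h2 := h.le_cube (X \ U)
    have h3 : g (X \ U) ^ 3 ≤ (1 / 2) ^ 3 :=
      pow_le_pow_left₀ (h.g_nonneg _) (by linarith [h.g_comp hU, h.g_le_one X]) 3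
    norm_num at h3
    linarith
  · push Not at hex
    have h1 := h.sum_le_of_comp (κ := 1 / 4) (by norm_num) X fun U hU => by
      have h2 := h.le_cube U
      have h3 := hex U hU
      have h4 := h.g_nonneg U
      have : g U ^ 2 ≤ (1 / 2) ^ 2 := pow_le_pow_left₀ h4 h3 2
      nlinarith
    linarith [h.g_le_one X]

/-- Graphs with no hole with a hat carry no controlled measure. -/
theorem Controlled.false (h : Controlled G w g) (hG : ¬ HasHoleWithHat G) : False := by
  have hb := h.isHaven
  have hv : ∃ v, 0 < w v := by
    by_contra! hv
    linarith [sum_nonpos fun v (_ : v ∈ univ) => hv v, h.sum_eq]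
  obtain ⟨v, hv⟩ := hv
  obtain ⟨K₁, hK₁, hbK₁⟩ := hb.exists_isComp v v v
    (Y := univ.filter fun z => z ≠ v ∧ ¬ G.Adj v z) (fun z hz _ _ => by simpa using hz)
  have hK₁m : ∀ z ∈ K₁, z ≠ v ∧ ¬ G.Adj v z := fun z hz => by simpa using hK₁.1 hz
  have hblock : IsBlock G (fun X => 1 / 2 < ∑ v ∈ X, w v) {v} K₁ := by
    refine ⟨by simp, hK₁.2.1, hbK₁, ?_, ?_⟩
    · intro a ha
      rw [mem_singleton] at ha
      exact ha ▸ hK₁m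
    · intro a ha s hs
      rw [mem_singleton] at ha
      subst ha
      obtain ⟨hsK, k, hk, hsk⟩ := mem_boundary.1 hs
      by_contra hvs
      refine hsK (hK₁.2.2 k hk s ?_ hsk.symm)
      simp only [mem_filter, mem_univ, true_and]
      exact ⟨fun hsv => (hK₁m k hk).2 (hsv ▸ hsk), hvs⟩
  obtain ⟨A, hAm, hmax⟩ := exists_max_image
    (univ.filter fun A => ∃ K, IsBlock G (fun X => 1 / 2 < ∑ v ∈ X, w v) A K) g
    ⟨{v}, mem_filter.2 ⟨mem_univ _, K₁, hblock⟩⟩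
  simp only [mem_filter, mem_univ, true_and] at hAm hmax
  obtain ⟨K₀, hA⟩ := hAm
  obtain ⟨K, hK, hbK, hAK, hQ⟩ := exists_separator hG hb hA
  have hpos : 0 < g A := by
    have h1 := h.le_cube {v}
    rw [sum_singleton] at h1
    have h2 : 0 < g {v} := by
      refine (h.g_nonneg _).lt_of_ne fun h0 => ?_
      rw [← h0] at h1
      norm_num at h1
      linarith
    exact h2.trans_le (hmax _ ⟨K₁, hblock⟩)
  set S := boundary G K with hS
  have hSK : Disjoint K S := disjoint_left.2 fun x hx hxS => (mem_boundary.1 hxS).1 hx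
  set T := univ \ (K ∪ S) with hT
  have hTm : ∀ z ∈ T, z ∉ K ∧ z ∉ S := fun z hz => by simpa [hT] using hz
  have hAT : A ⊆ T := fun a ha => by simpa [hT] using hAK a ha
  have hTg := h.g_add T K (disjoint_left.2 fun z hz => (hTm z hz).1) fun a ha b hb' hab =>
    (hTm a ha).2 (mem_boundary.2 ⟨(hTm a ha).1, b, hb', hab⟩)
  have hsum : ∑ v ∈ T, w v + (∑ v ∈ K, w v + ∑ v ∈ S, w v) = 1 := by
    rw [← sum_union hSK, ← h.sum_eq, hT, sum_sdiff (subset_univ _)]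
  have hSw := h.sum_le_of_comp (κ := g A ^ 2) (by positivity) S fun U hU => by
    have h1 := h.le_cube U
    have h2 := hmax U (hQ U hU)
    have h3 := h.g_nonneg U
    have : g U ^ 2 ≤ g A ^ 2 := pow_le_pow_left₀ h3 h2 2
    nlinarith
  have hAt := h.g_mono _ _ hAT
  have hK3 := h.le_cube K
  have hT3 := h.le_cube T
  have hle := h.g_le_one (T ∪ K)
  have hS2 : g A ^ 2 * g S ≤ g T ^ 2 := by
    have h1 := h.g_le_one S
    have h2 := h.g_nonneg S
    have : g A ^ 2 ≤ g T ^ 2 := pow_le_pow_left₀ hpos.le hAt 2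
    nlinarith [sq_nonneg (g A)]
  have hKg := h.g_nonneg K
  have hK2 : 1 / 2 < g K := by
    by_contra! hk
    have : g K ^ 3 ≤ (1 / 2) ^ 3 := pow_le_pow_left₀ hKg hk 3
    norm_num at this
    linarith
  have hK3' : g K ^ 3 ≤ (1 - g T) ^ 3 := pow_le_pow_left₀ hKg (by linarith) 3
  have ht : g T < 1 / 2 := by linarith
  have ht0 : 0 < g T := hpos.trans_le hAt
  nlinarith

/-- Complements of graphs with no hole with a hat carry no controlled measure. -/
theorem Controlled.false_of_compl (h : Controlled Gᶜ w g) (hG : ¬ HasHoleWithHat G) : False := by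
  have : Nonempty V := by
    by_contra hV
    rw [not_nonempty_iff] at hV
    simpa using h.sum_eq
  obtain ⟨a, b, c, d, e, hab, hbc, hcd, hde, hac, had, hae, hbd, hbe, hce⟩ := h.isHaven.exists_path
  simp only [SimpleGraph.compl_adj, not_and, not_not] at *
  exact hG (hasHoleWithHat_of_house (hac.2 hac.1) (had.2 had.1) (hae.2 hae.1) (hbd.2 hbd.1)
    (hbe.2 hbe.1) (hce.2 hce.1) hab.2 hbc hcd hde.2)

end Measure

section Regularity

open scoped Classical

/-- The pattern `H` on `0, …, n - 1` occurs in `G` as an induced subgraph. -/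
def HasPattern (n : ℕ) (H : ℕ → ℕ → Prop) (G : SimpleGraph V) : Prop :=
  ∃ v : ℕ → V, ∀ j i, j < i → i < n → v i ≠ v j ∧ (G.Adj (v i) (v j) ↔ H i j)

/-- The non-adjacency relation on distinct vertices. -/
def coAdj (G : SimpleGraph V) (a b : V) : Prop := b ≠ a ∧ ¬ G.Adj a b

/-- If a pattern does not occur across prescribed large sets, then there is a large pair of sets
which is very sparse or very dense. -/
theorem exists_sparse_or_dense_pair (H : ℕ → ℕ → Prop) {ε : ℝ} (hε : 0 < ε) (n : ℕ) :
    ∃ δ : ℝ, 0 < δ ∧ ∀ {V : Type} [Fintype V] [Nonempty V] (G : SimpleGraph V) (μ : V → ℝ),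
      (∀ v, 0 ≤ μ v) → ∀ (X : Finset V) (W : ℕ → Finset V) (c : ℝ), 0 < c →
      (∀ i < n, W i ⊆ X ∧ c ≤ ∑ v ∈ W i, μ v) →
      (∃ v : ℕ → V, (∀ i < n, v i ∈ W i) ∧
        ∀ j i, j < i → i < n → v i ≠ v j ∧ (G.Adj (v i) (v j) ↔ H i j)) ∨
      ∃ A ⊆ X, ∃ B ⊆ X, δ * c ≤ ∑ v ∈ A, μ v ∧ δ * c ≤ ∑ v ∈ B, μ v ∧
        ((∀ a ∈ A, ∑ b ∈ B with G.Adj a b, μ b ≤ ε * ∑ b ∈ B, μ b) ∨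
          ∀ a ∈ A, ∑ b ∈ B with coAdj G a b, μ b ≤ ε * ∑ b ∈ B, μ b) := by
  induction n with
  | zero =>
    refine ⟨1, one_pos, fun G μ _ X W c _ _ => Or.inl ?_⟩
    exact ⟨fun _ => Classical.arbitrary _, by simp, by simp⟩
  | succ n ih =>
  obtain ⟨δ, hδ, ih⟩ := ih
  refine ⟨min (δ * ε) (1 / (n + 1)), by positivity, fun {V} _ _ G μ hμ X W c hc hW => ?_⟩
  have hmin1 : min (δ * ε) (1 / (n + 1 : ℝ)) * c ≤ δ * (ε * c) := by
    have := mul_le_mul_of_nonneg_right (min_le_left (δ * ε) (1 / (n + 1 : ℝ))) hc.le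
    linarith
  have hmin2 : min (δ * ε) (1 / (n + 1 : ℝ)) * c ≤ 1 / (n + 1) * c :=
    mul_le_mul_of_nonneg_right (min_le_right _ _) hc.le
  let P : ℕ → V → V → Prop := fun j a b => if H n j then G.Adj a b else coAdj G a b
  have hP : ∀ j a b, P j a b → a ≠ b ∧ (G.Adj a b ↔ H n j) := by
    intro j a b h
    by_cases hj : H n j
    · simp only [P, hj, if_true] at h
      exact ⟨h.ne, by simp [h, hj]⟩
    · simp only [P, hj, if_false] at h
      exact ⟨h.1.symm, by simp [h.2, hj]⟩
  by_cases hgood : ∃ a ∈ W n, ∀ j < n, ε * ∑ b ∈ W j, μ b < ∑ b ∈ W j with P j a b, μ b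
  · obtain ⟨a, ha, hgood⟩ := hgood
    rcases ih G μ hμ X (fun j => (W j).filter (P j a)) (ε * c) (by positivity) (fun j hj =>
      ⟨(filter_subset _ _).trans (hW j (by omega)).1, le_trans
        (mul_le_mul_of_nonneg_left (hW j (by omega)).2 hε.le) (hgood j hj).le⟩) with h | h
    · obtain ⟨v, hv, hvH⟩ := h
      simp only [mem_filter] at hv
      refine Or.inl ⟨Function.update v n a, fun i hi => ?_, fun j i hji hi => ?_⟩
      · rcases Nat.lt_succ_iff_lt_or_eq.1 hi with h | rfl
        · rw [Function.update_of_ne (by omega)]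
          exact (hv i h).1
        · simpa using ha
      · rw [Function.update_of_ne (a := j) (by omega)]
        rcases Nat.lt_succ_iff_lt_or_eq.1 hi with h | rfl
        · rw [Function.update_of_ne (by omega)]
          exact hvH j i hji h
        · rw [Function.update_self]
          exact hP j _ _ (hv j hji).2
    · obtain ⟨A, hA, B, hB, h1, h2, h3⟩ := h
      exact Or.inr ⟨A, hA, B, hB, hmin1.trans h1, hmin1.trans h2, h3⟩
  · push Not at hgood
    let Bad : ℕ → Finset V := fun j =>
      (W n).filter fun a => ∑ b ∈ W j with P j a b, μ b ≤ ε * ∑ b ∈ W j, μ b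
    have hex : ∃ j < n, 1 / (n + 1) * c ≤ ∑ v ∈ Bad j, μ v := by
      by_contra! hcon
      have h1 : ∑ v ∈ W n, μ v ≤ ∑ j ∈ range n, ∑ v ∈ Bad j, μ v := by
        have e : ∀ j, ∑ v ∈ Bad j, μ v = ∑ a ∈ W n,
            if ∑ b ∈ W j with P j a b, μ b ≤ ε * ∑ b ∈ W j, μ b then μ a else 0 :=
          fun j => sum_filter _ _
        rw [sum_congr rfl fun j _ => e j, sum_comm]
        refine sum_le_sum fun a ha => ?_
        obtain ⟨j, hj, hja⟩ := hgood a ha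
        have := single_le_sum (f := fun j =>
          if ∑ b ∈ W j with P j a b, μ b ≤ ε * ∑ b ∈ W j, μ b then μ a else 0) (s := range n)
          (fun i _ => by
            split_ifs
            exacts [hμ a, le_rfl]) (mem_range.2 hj)
        rwa [if_pos hja] at this
      have h2 : ∑ j ∈ range n, ∑ v ∈ Bad j, μ v ≤ ∑ j ∈ range n, 1 / (n + 1) * c :=
        sum_le_sum fun j hj => (hcon j (mem_range.1 hj)).le
      rw [sum_const, card_range, nsmul_eq_mul] at h2
      have h3 : (n : ℝ) * (1 / (n + 1) * c) < c := by
        have : (n : ℝ) * (1 / (n + 1) * c) = n / (n + 1) * c := by ring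
        rw [this]
        have : (n : ℝ) / (n + 1) < 1 := (div_lt_one (by positivity)).2 (by linarith)
        nlinarith
      linarith [(hW n (by omega)).2]
    obtain ⟨j, hj, hjc⟩ := hex
    have hn1 : 1 / (n + 1 : ℝ) ≤ 1 := (div_le_one (by positivity)).2 (by linarith [n.cast_nonneg (α := ℝ)])
    refine Or.inr ⟨Bad j, (filter_subset _ _).trans (hW n (by omega)).1, W j,
      (hW j (by omega)).1, hmin2.trans hjc, ?_, ?_⟩
    · have := (hW j (by omega)).2
      nlinarith
    · have hb : ∀ a ∈ Bad j, ∑ b ∈ W j with P j a b, μ b ≤ ε * ∑ b ∈ W j, μ b :=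
        fun a ha => (mem_filter.1 ha).2
      by_cases hH : H n j
      · left
        simpa only [P, hH, if_true] using hb
      · right
        simpa only [P, hH, if_false] using hb

/-- The weighted degree of `a` in the relation `R`. -/
noncomputable def wdeg [Fintype V] (R : V → V → Prop) (ν : V → ℝ) (a : V) : ℝ :=
  ∑ b with R a b, ν b

lemma sum_mul_wdeg_comm [Fintype V] {R : V → V → Prop} (hR : ∀ a b, R a b → R b a)
    (ν ν' : V → ℝ) : ∑ a, ν a * wdeg R ν' a = ∑ a, ν' a * wdeg R ν a := by
  simp only [wdeg, sum_filter, mul_sum]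
  rw [sum_comm]
  refine sum_congr rfl fun a _ => sum_congr rfl fun b _ => ?_
  by_cases h : R a b
  · simp [h, hR a b h, mul_comm]
  · have : ¬ R b a := fun h' => h (hR b a h')
    simp [h, this]

lemma wdeg_nonneg [Fintype V] {R : V → V → Prop} {ν : V → ℝ} (h0 : ∀ v, 0 ≤ ν v) (a : V) :
    0 ≤ wdeg R ν a := sum_nonneg fun b _ => h0 b

lemma sum_mul_wdeg_le [Fintype V] {R : V → V → Prop} {ν ν' : V → ℝ} {c : ℝ}
    (h0 : ∀ v, 0 ≤ ν v) (h1 : ∑ v, ν v = 1) (h : ∀ a, ν a ≠ 0 → wdeg R ν' a ≤ c) :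
    ∑ a, ν a * wdeg R ν' a ≤ c := by
  have : ∑ a, ν a * wdeg R ν' a ≤ ∑ a, ν a * c := by
    refine sum_le_sum fun a _ => ?_
    by_cases ha : ν a = 0
    · simp [ha]
    · exact mul_le_mul_of_nonneg_left (h a ha) (h0 a)
  rwa [← sum_mul, h1, one_mul] at this

lemma wdeg_le_one [Fintype V] {R : V → V → Prop} {ν : V → ℝ} (h0 : ∀ v, 0 ≤ ν v)
    (h1 : ∑ v, ν v = 1) (a : V) : wdeg R ν a ≤ 1 := by
  rw [← h1]
  exact sum_le_sum_of_subset_of_nonneg (filter_subset _ _) fun b _ _ => h0 b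

/-- Mixing two measures with small cross density. -/
lemma sum_mul_wdeg_mix_le [Fintype V] {R : V → V → Prop} (hR : ∀ a b, R a b → R b a)
    {ν ν' : V → ℝ} (h0 : ∀ v, 0 ≤ ν v) (h1 : ∑ v, ν v = 1) (h0' : ∀ v, 0 ≤ ν' v)
    (h1' : ∑ v, ν' v = 1) {ε s : ℝ} (hε : 0 ≤ ε) (hs : 0 < s)
    (hν : ∑ a, ν a * wdeg R ν a ≤ 1 / s + ε) (hc : ∀ a, ν a ≠ 0 → wdeg R ν' a ≤ ε) :
    ∑ a, (s / (s + 1) * ν a + 1 / (s + 1) * ν' a) *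
      wdeg R (fun b => s / (s + 1) * ν b + 1 / (s + 1) * ν' b) a ≤ 1 / (s + 1) + ε := by
  set p := s / (s + 1) with hp
  set r := 1 / (s + 1) with hr
  have hlin : ∀ a, wdeg R (fun b => p * ν b + r * ν' b) a = p * wdeg R ν a + r * wdeg R ν' a := by
    intro a
    simp only [wdeg, sum_add_distrib, mul_sum]
  have hexp : ∑ a, (p * ν a + r * ν' a) * wdeg R (fun b => p * ν b + r * ν' b) a =
      p ^ 2 * ∑ a, ν a * wdeg R ν a + p * r * ∑ a, ν a * wdeg R ν' a +
        p * r * ∑ a, ν' a * wdeg R ν a + r ^ 2 * ∑ a, ν' a * wdeg R ν' a := by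
    simp only [hlin, mul_sum, ← sum_add_distrib]
    exact sum_congr rfl fun a _ => by ring
  rw [hexp, sum_mul_wdeg_comm hR ν' ν]
  have hx := sum_mul_wdeg_le h0 h1 hc
  have hy := sum_mul_wdeg_le (R := R) h0' h1' (c := 1) fun a _ => wdeg_le_one h0' h1' a
  have hp0 : 0 ≤ p := by positivity
  have hr0 : 0 ≤ r := by positivity
  have hpr : p + r = 1 := by rw [hp, hr]; field_simp
  have hps : p ^ 2 * (1 / s) + r ^ 2 = r := by rw [hp, hr]; field_simp
  have e1 : p ^ 2 * ∑ a, ν a * wdeg R ν a ≤ p ^ 2 * (1 / s + ε) :=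
    mul_le_mul_of_nonneg_left hν (by positivity)
  have e2 : p * r * ∑ a, ν a * wdeg R ν' a ≤ p * r * ε :=
    mul_le_mul_of_nonneg_left hx (by positivity)
  have e3 : r ^ 2 * ∑ a, ν' a * wdeg R ν' a ≤ r ^ 2 * 1 :=
    mul_le_mul_of_nonneg_left hy (by positivity)
  have e4 : (p ^ 2 + 2 * (p * r)) * ε ≤ 1 * ε := by
    refine mul_le_mul_of_nonneg_right ?_ hε
    nlinarith
  linarith

lemma coAdj_symm {G : SimpleGraph V} (a b : V) (h : coAdj G a b) : coAdj G b a :=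
  ⟨h.1.symm, fun h' => h.2 h'.symm⟩

/-- Normalized restriction of a measure to a set. -/
noncomputable def restrictProb (μ : V → ℝ) (B : Finset V) (v : V) : ℝ :=
  if v ∈ B then μ v / ∑ b ∈ B, μ b else 0

lemma restrictProb_nonneg {μ : V → ℝ} (hμ : ∀ v, 0 ≤ μ v) (B : Finset V) (v : V) :
    0 ≤ restrictProb μ B v := by
  unfold restrictProb
  split_ifs
  · exact div_nonneg (hμ v) (sum_nonneg fun b _ => hμ b)
  · exact le_rfl

lemma sum_filter_restrictProb [Fintype V] (μ : V → ℝ) (B : Finset V) (p : V → Prop) :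
    ∑ v with p v, restrictProb μ B v = (∑ v ∈ B with p v, μ v) / ∑ b ∈ B, μ b := by
  unfold restrictProb
  rw [← sum_filter, sum_div, filter_filter]
  refine sum_congr ?_ fun _ _ => rfl
  ext v
  simp [and_comm]

lemma sum_restrictProb [Fintype V] {μ : V → ℝ} {B : Finset V} (hB : 0 < ∑ b ∈ B, μ b) :
    ∑ v, restrictProb μ B v = 1 := by
  have := sum_filter_restrictProb μ B fun _ => True
  simpa [div_self hB.ne'] using this

lemma mul_restrictProb_le {μ : V → ℝ} (hμ : ∀ v, 0 ≤ μ v) {B : Finset V}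
    (hB : 0 < ∑ b ∈ B, μ b) (v : V) : (∑ b ∈ B, μ b) * restrictProb μ B v ≤ μ v := by
  unfold restrictProb
  split_ifs
  · rw [mul_div_cancel₀ _ hB.ne']
  · simpa using hμ v

/-- One mixing step in the construction of a measure of small density. -/
lemma exists_mix [Fintype V] {R : V → V → Prop} (hR : ∀ a b, R a b → R b a) {μ : V → ℝ}
    (hμ : ∀ v, 0 ≤ μ v) {X A B : Finset V} {δ δ' δ'' ε s : ℝ} (hε : 0 ≤ ε) (hs : 0 < s)
    (hAX : A ⊆ X) (hBX : B ⊆ X) (hδ : 0 < δ) (hX : 0 < ∑ v ∈ X, μ v)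
    (hA : δ * ∑ v ∈ X, μ v ≤ ∑ v ∈ A, μ v) (hB : δ * ∑ v ∈ X, μ v ≤ ∑ v ∈ B, μ v)
    (hR' : ∀ a ∈ A, ∑ b ∈ B with R a b, μ b ≤ ε * ∑ b ∈ B, μ b)
    (hδδ' : δ'' ≤ δ * δ') (hδδ : δ'' ≤ δ) (hδ' : 0 ≤ δ')
    {ν : V → ℝ} (h0 : ∀ v, 0 ≤ ν v) (hsupp : ∀ v, v ∉ A → ν v = 0) (h1 : ∑ v, ν v = 1)
    (hν : ∀ v, δ' * (∑ v ∈ A, μ v) * ν v ≤ μ v)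
    (hq : ∑ a, ν a * wdeg R ν a ≤ 1 / s + ε) :
    ∃ ν : V → ℝ, (∀ v, 0 ≤ ν v) ∧ (∀ v, v ∉ X → ν v = 0) ∧ ∑ v, ν v = 1 ∧
      (∀ v, δ'' * (∑ v ∈ X, μ v) * ν v ≤ μ v) ∧
      ∑ a, ν a * wdeg R ν a ≤ 1 / (s + 1) + ε := by
  have hBpos : 0 < ∑ v ∈ B, μ v := lt_of_lt_of_le (by positivity) hB
  set p := s / (s + 1) with hp
  set r := 1 / (s + 1) with hr
  have hp0 : 0 ≤ p := by positivity
  have hr0 : 0 ≤ r := by positivity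
  have hpr : p + r = 1 := by rw [hp, hr]; field_simp
  have g0 := restrictProb_nonneg hμ B
  refine ⟨fun v => p * ν v + r * restrictProb μ B v, fun v => ?_, fun v hv => ?_, ?_, fun v => ?_,
    sum_mul_wdeg_mix_le hR h0 h1 g0 (sum_restrictProb hBpos) hε hs hq fun a ha => ?_⟩
  · have := h0 v
    have := g0 v
    positivity
  · have hvB : v ∉ B := fun h => hv (hBX h)
    simp [hsupp v fun h => hv (hAX h), restrictProb, hvB]
  · rw [sum_add_distrib, ← mul_sum, ← mul_sum, h1, sum_restrictProb hBpos]
    linarith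
  · have e1 : δ'' * (∑ v ∈ X, μ v) * ν v ≤ μ v := by
      refine le_trans (mul_le_mul_of_nonneg_right ?_ (h0 v)) (hν v)
      calc δ'' * (∑ v ∈ X, μ v) ≤ δ * δ' * ∑ v ∈ X, μ v :=
            mul_le_mul_of_nonneg_right hδδ' hX.le
        _ = δ' * (δ * ∑ v ∈ X, μ v) := by ring
        _ ≤ _ := mul_le_mul_of_nonneg_left hA hδ'
    have e2 : δ'' * (∑ v ∈ X, μ v) * restrictProb μ B v ≤ μ v :=
      le_trans (mul_le_mul_of_nonneg_right
        ((mul_le_mul_of_nonneg_right hδδ hX.le).trans hB) (g0 v)) (mul_restrictProb_le hμ hBpos v)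
    have e3 := mul_le_mul_of_nonneg_left e1 hp0
    have e4 := mul_le_mul_of_nonneg_left e2 hr0
    have e5 : p * μ v + r * μ v = μ v := by rw [← add_mul, hpr, one_mul]
    linarith
  · have haA : a ∈ A := by
      by_contra h
      exact ha (hsupp a h)
    rw [wdeg, sum_filter_restrictProb, div_le_iff₀ hBpos]
    exact hR' a haA

/-- A graph without a given pattern has a measure, not much larger than a given one, with very
small density or very small co-density. -/
theorem exists_measure_small_density (n : ℕ) (H : ℕ → ℕ → Prop) {ε : ℝ} (hε : 0 < ε) (s t : ℕ) :
    ∃ δ : ℝ, 0 < δ ∧ ∀ {V : Type} [Fintype V] (G : SimpleGraph V) (μ : V → ℝ),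
      (∀ v, 0 ≤ μ v) → ¬ HasPattern n H G → ∀ X : Finset V, 0 < ∑ v ∈ X, μ v →
      ∃ ν : V → ℝ, (∀ v, 0 ≤ ν v) ∧ (∀ v, v ∉ X → ν v = 0) ∧ ∑ v, ν v = 1 ∧
        (∀ v, δ * (∑ v ∈ X, μ v) * ν v ≤ μ v) ∧
        (∑ a, ν a * wdeg G.Adj ν a ≤ 1 / ((s : ℝ) + 1) + ε ∨
          ∑ a, ν a * wdeg (coAdj G) ν a ≤ 1 / ((t : ℝ) + 1) + ε) := by
  have base : ∀ {V : Type} [Fintype V] (R : V → V → Prop) (μ : V → ℝ), (∀ v, 0 ≤ μ v) →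
      ∀ X : Finset V, 0 < ∑ v ∈ X, μ v →
      ∃ ν : V → ℝ, (∀ v, 0 ≤ ν v) ∧ (∀ v, v ∉ X → ν v = 0) ∧ ∑ v, ν v = 1 ∧
        (∀ v, 1 * (∑ v ∈ X, μ v) * ν v ≤ μ v) ∧ ∑ a, ν a * wdeg R ν a ≤ 1 := by
    intro V _ R μ hμ X hX
    refine ⟨restrictProb μ X, restrictProb_nonneg hμ X, fun v hv => by simp [restrictProb, hv],
      sum_restrictProb hX, by simpa using mul_restrictProb_le hμ hX, ?_⟩
    exact sum_mul_wdeg_le (restrictProb_nonneg hμ X) (sum_restrictProb hX)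
      fun a _ => wdeg_le_one (restrictProb_nonneg hμ X) (sum_restrictProb hX) a
  induction hk : s + t generalizing s t with
  | zero =>
    obtain ⟨rfl, rfl⟩ : s = 0 ∧ t = 0 := by omega
    refine ⟨1, one_pos, fun {V} _ G μ hμ _ X hX => ?_⟩
    obtain ⟨ν, h1, h2, h3, h4, h5⟩ := base G.Adj μ hμ X hX
    exact ⟨ν, h1, h2, h3, h4, Or.inl (h5.trans (by norm_num; linarith))⟩
  | succ k ih =>
  rcases Nat.eq_zero_or_pos s with rfl | hs
  · refine ⟨1, one_pos, fun {V} _ G μ hμ _ X hX => ?_⟩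
    obtain ⟨ν, h1, h2, h3, h4, h5⟩ := base G.Adj μ hμ X hX
    exact ⟨ν, h1, h2, h3, h4, Or.inl (h5.trans (by norm_num; linarith))⟩
  rcases Nat.eq_zero_or_pos t with rfl | ht
  · refine ⟨1, one_pos, fun {V} _ G μ hμ _ X hX => ?_⟩
    obtain ⟨ν, h1, h2, h3, h4, h5⟩ := base (coAdj G) μ hμ X hX
    exact ⟨ν, h1, h2, h3, h4, Or.inr (h5.trans (by norm_num; linarith))⟩
  obtain ⟨s, rfl⟩ := Nat.exists_eq_add_of_lt hs
  obtain ⟨t, rfl⟩ := Nat.exists_eq_add_of_lt ht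
  simp only [zero_add] at *
  obtain ⟨δ, hδ, hpair⟩ := exists_sparse_or_dense_pair H hε n
  obtain ⟨δ₁, hδ₁, ih₁⟩ := ih s (t + 1) (by omega)
  obtain ⟨δ₂, hδ₂, ih₂⟩ := ih (s + 1) t (by omega)
  set δ₃ := δ * min 1 (min δ₁ δ₂) with hδ₃
  have hm1 : δ₃ ≤ δ * δ₁ := mul_le_mul_of_nonneg_left ((min_le_right _ _).trans (min_le_left _ _)) hδ.le
  have hm2 : δ₃ ≤ δ * δ₂ := mul_le_mul_of_nonneg_left ((min_le_right _ _).trans (min_le_right _ _)) hδ.le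
  have hm0 : δ₃ ≤ δ := by
    have := mul_le_mul_of_nonneg_left (min_le_left 1 (min δ₁ δ₂)) hδ.le
    linarith
  have hpos : 0 < δ₃ := by positivity
  refine ⟨δ₃, hpos, fun {V} _ G μ hμ hG X hX => ?_⟩
  have : Nonempty V := by
    by_contra hV
    rw [not_nonempty_iff] at hV
    rw [Subsingleton.elim X ∅] at hX
    simp at hX
  rcases hpair G μ hμ X (fun _ => X) _ hX (fun i _ => ⟨le_rfl, le_rfl⟩) with
    ⟨v, -, hv⟩ | ⟨A, hAX, B, hBX, hA, hB, hAB⟩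
  · exact absurd ⟨v, hv⟩ hG
  have hApos : 0 < ∑ v ∈ A, μ v := lt_of_lt_of_le (by positivity) hA
  -- weakening a measure on `A` to one on `X`
  have weaken : ∀ {δ' : ℝ} {ν : V → ℝ}, 0 ≤ δ' → δ₃ ≤ δ * δ' → (∀ v, 0 ≤ ν v) →
      (∀ v, δ' * (∑ v ∈ A, μ v) * ν v ≤ μ v) → ∀ v, δ₃ * (∑ v ∈ X, μ v) * ν v ≤ μ v := by
    intro δ' ν hδ' hδδ' h0 hν v
    refine le_trans (mul_le_mul_of_nonneg_right ?_ (h0 v)) (hν v)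
    calc δ₃ * (∑ v ∈ X, μ v) ≤ δ * δ' * ∑ v ∈ X, μ v :=
          mul_le_mul_of_nonneg_right hδδ' hX.le
      _ = δ' * (δ * ∑ v ∈ X, μ v) := by ring
      _ ≤ _ := mul_le_mul_of_nonneg_left hA hδ'
  push_cast
  rcases hAB with hAB | hAB
  · obtain ⟨ν, h0, hsupp, h1, hν, hq⟩ := ih₁ G μ hμ hG A hApos
    push_cast at hq
    rcases hq with hq | hq
    · obtain ⟨ν', g0, gs, g1, gν, gq⟩ := exists_mix (fun _ _ h => h.symm) hμ hε.le
        (s := (s : ℝ) + 1) (by positivity) hAX hBX hδ hX hA hB hAB hm1 hm0 hδ₁.le h0 hsupp h1 hν hq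
      exact ⟨ν', g0, gs, g1, gν, Or.inl gq⟩
    · exact ⟨ν, h0, fun v hv => hsupp v fun h => hv (hAX h), h1, weaken hδ₁.le hm1 h0 hν, Or.inr hq⟩
  · obtain ⟨ν, h0, hsupp, h1, hν, hq⟩ := ih₂ G μ hμ hG A hApos
    push_cast at hq
    rcases hq with hq | hq
    · exact ⟨ν, h0, fun v hv => hsupp v fun h => hv (hAX h), h1, weaken hδ₂.le hm2 h0 hν, Or.inl hq⟩
    · obtain ⟨ν', g0, gs, g1, gν, gq⟩ := exists_mix coAdj_symm hμ hε.le
        (s := (t : ℝ) + 1) (by positivity) hAX hBX hδ hX hA hB hAB hm2 hm0 hδ₂.le h0 hsupp h1 hν hq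
      exact ⟨ν', g0, gs, g1, gν, Or.inr gq⟩

/-- Restricting to low-degree vertices turns small average degree into small maximum degree. -/
lemma exists_measure_small_wdeg [Fintype V] {R : V → V → Prop} {ν : V → ℝ} {η : ℝ} (hη : 0 < η)
    (h0 : ∀ v, 0 ≤ ν v) (h1 : ∑ v, ν v = 1) (hq : ∑ a, ν a * wdeg R ν a ≤ η) :
    ∃ w : V → ℝ, (∀ v, 0 ≤ w v) ∧ ∑ v, w v = 1 ∧ (∀ v, w v ≤ 2 * ν v) ∧
      ∀ v, w v ≠ 0 → wdeg R w v ≤ 4 * η := by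
  set L : Finset V := univ.filter fun v => wdeg R ν v ≤ 2 * η with hL
  have hhalf : 1 / 2 ≤ ∑ v ∈ L, ν v := by
    have h2 : ∑ v, ν v * (2 * η) ≤ ∑ a, ν a * wdeg R ν a + ∑ v ∈ L, ν v * (2 * η) := by
      rw [hL, sum_filter, ← sum_add_distrib]
      refine sum_le_sum fun v _ => ?_
      split_ifs with h
      · linarith [mul_nonneg (h0 v) (wdeg_nonneg (R := R) h0 v)]
      · linarith [mul_le_mul_of_nonneg_left (not_le.1 h).le (h0 v)]
    rw [← sum_mul, ← sum_mul, h1] at h2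
    nlinarith
  have hLpos : 0 < ∑ v ∈ L, ν v := by linarith
  have hle : ∀ v, restrictProb ν L v ≤ 2 * ν v := by
    intro v
    have e1 := mul_restrictProb_le h0 hLpos v
    have e2 := restrictProb_nonneg h0 L v
    nlinarith
  refine ⟨restrictProb ν L, restrictProb_nonneg h0 L, sum_restrictProb hLpos, hle, fun v hv => ?_⟩
  have hvL : v ∈ L := by
    by_contra h
    exact hv (by simp [restrictProb, h])
  have hvd : wdeg R ν v ≤ 2 * η := by simpa [hL] using hvL
  have : wdeg R (restrictProb ν L) v ≤ 2 * wdeg R ν v := by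
    rw [wdeg, wdeg, mul_sum]
    exact sum_le_sum fun b _ => hle b
  linarith

/-- Graphs without a given pattern have a measure, not much larger than a given one, all of whose
degrees or all of whose co-degrees are small. -/
theorem exists_measure_wdeg_le (n : ℕ) (H : ℕ → ℕ → Prop) :
    ∃ δ : ℝ, 0 < δ ∧ ∀ {V : Type} [Fintype V] (G : SimpleGraph V) (μ : V → ℝ),
      (∀ v, 0 ≤ μ v) → ∑ v, μ v = 1 → ¬ HasPattern n H G →
      ∃ w : V → ℝ, (∀ v, 0 ≤ w v) ∧ ∑ v, w v = 1 ∧ (∀ v, δ * w v ≤ μ v) ∧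
        ((∀ v, w v ≠ 0 → wdeg G.Adj w v ≤ 1 / 40) ∨
          ∀ v, w v ≠ 0 → wdeg (coAdj G) w v ≤ 1 / 40) := by
  obtain ⟨δ, hδ, h⟩ := exists_measure_small_density n H (ε := 1 / 320) (by norm_num) 319 319
  refine ⟨δ / 2, by positivity, fun {V} _ G μ hμ hμ1 hG => ?_⟩
  obtain ⟨ν, h0, -, h1, hν, hq⟩ := h G μ hμ hG univ (by rw [hμ1]; exact one_pos)
  norm_num [hμ1] at hν hq
  have fin : ∀ R : V → V → Prop, ∑ a, ν a * wdeg R ν a ≤ 1 / 160 →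
      ∃ w : V → ℝ, (∀ v, 0 ≤ w v) ∧ ∑ v, w v = 1 ∧ (∀ v, δ / 2 * w v ≤ μ v) ∧
        ∀ v, w v ≠ 0 → wdeg R w v ≤ 1 / 40 := by
    intro R hR
    obtain ⟨w, hw0, hw1, hw, hd⟩ := exists_measure_small_wdeg (by norm_num) h0 h1 hR
    refine ⟨w, hw0, hw1, fun v => ?_, fun v hv => (hd v hv).trans (by norm_num)⟩
    have := mul_le_mul_of_nonneg_left (hw v) (by positivity : 0 ≤ δ / 2)
    linarith [hν v]
  rcases hq with hq | hq
  · obtain ⟨w, a, b, c, d⟩ := fin _ hq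
    exact ⟨w, a, b, c, Or.inl d⟩
  · obtain ⟨w, a, b, c, d⟩ := fin _ hq
    exact ⟨w, a, b, c, Or.inr d⟩

end Regularity

section Concentration

open scoped Classical

/-- A monotone set function that is superadditive on disjoint pairs that are anticomplete or
complete to each other. -/
structure SplitSuperadditive (G : SimpleGraph V) (g : Finset V → ℝ) : Prop where
  nonneg : ∀ X, 0 ≤ g X
  mono : ∀ X Y, X ⊆ Y → g X ≤ g Y
  add_anti : ∀ A B, Disjoint A B → (∀ a ∈ A, ∀ b ∈ B, ¬ G.Adj a b) → g A + g B ≤ g (A ∪ B)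
  add_complete : ∀ A B, Disjoint A B → (∀ a ∈ A, ∀ b ∈ B, G.Adj a b) → g A + g B ≤ g (A ∪ B)

lemma HasHoleWithHat.of_comap {G : SimpleGraph V} {Z : Finset V}
    (h : HasHoleWithHat (G.comap (Subtype.val : {v // v ∈ Z} → V))) : HasHoleWithHat G := by
  obtain ⟨n, c, v, i, ⟨h4, hinj, hadj⟩, hv, hvadj⟩ := h
  exact ⟨n, fun j => (c j).1, v.1, i, ⟨h4, Subtype.val_injective.comp hinj, hadj⟩,
    fun j e => hv j (Subtype.ext e), hvadj⟩

lemma hasHoleWithHat_of_hasPattern {G : SimpleGraph V}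
    (h : HasPattern 5 (fun i j => i ≠ j + 1) G) : HasHoleWithHat G := by
  obtain ⟨v, hv⟩ := h
  have key : ∀ j i, j < i → i < 5 → i ≠ j + 1 → G.Adj (v j) (v i) :=
    fun j i hji hi h => ((hv j i hji hi).2.2 h).symm
  have key' : ∀ j, j + 1 < 5 → v j ≠ v (j + 1) ∧ ¬ G.Adj (v j) (v (j + 1)) := fun j hj =>
    ⟨(hv j (j + 1) (by omega) hj).1.symm, fun h =>
      (hv j (j + 1) (by omega) hj).2.1 h.symm rfl⟩
  exact hasHoleWithHat_of_house (a := v 0) (b := v 1) (c := v 2) (d := v 3) (e := v 4)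
    (key 0 2 (by omega) (by omega) (by omega)) (key 0 3 (by omega) (by omega) (by omega))
    (key 0 4 (by omega) (by omega) (by omega)) (key 1 3 (by omega) (by omega) (by omega))
    (key 1 4 (by omega) (by omega) (by omega)) (key 2 4 (by omega) (by omega) (by omega))
    (key' 0 (by omega)).2 (key' 1 (by omega)) (key' 2 (by omega)) (key' 3 (by omega)).2

/-- Passing to a set maximizing the ratio of `w` to the cube of `g`. -/
lemma exists_cube_bound [Fintype V] {w : V → ℝ} {g : Finset V → ℝ} (hw : ∀ v, 0 ≤ w v)
    (hw1 : ∑ v, w v = 1) (hg : ∀ X, 0 ≤ g X) (hmono : ∀ X Y, X ⊆ Y → g X ≤ g Y)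
    (hg1 : g univ = 1) {k : ℕ} (hwg : ∀ Y, ∑ v ∈ Y, w v ≤ 2 ^ k * g Y ^ (3 * k + 11)) :
    ∃ Z : Finset V, (∀ v ∈ Z, w v ≠ 0) ∧ 1 / 2 ≤ ∑ v ∈ Z, w v ∧ 0 < g Z ∧
      ∀ Y ⊆ Z, (∑ v ∈ Y, w v) / ∑ v ∈ Z, w v ≤ (g Y / g Z) ^ 3 := by
  have hpos : ∀ Y, 0 < ∑ v ∈ Y, w v → 0 < g Y := by
    intro Y hY
    refine (hg Y).lt_of_ne fun h => ?_
    have := hwg Y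
    rw [← h, zero_pow (by omega), mul_zero] at this
    linarith
  set L : Finset V := univ.filter fun v => w v ≠ 0 with hL
  have hwL : ∑ v ∈ L, w v = 1 := by rw [hL, sum_filter_ne_zero, hw1]
  obtain ⟨Z, hZ, hmax⟩ := exists_max_image (L.powerset.filter fun Y => 0 < ∑ v ∈ Y, w v)
    (fun Y => (∑ v ∈ Y, w v) / g Y ^ 3) ⟨L, by simp [hwL]⟩
  simp only [mem_filter, mem_powerset] at hZ hmax
  have hgZ := hpos Z hZ.2
  have hgZ1 : g Z ≤ 1 := hg1 ▸ hmono _ _ (subset_univ Z)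
  have h1 : g Z ^ 3 ≤ ∑ v ∈ Z, w v := by
    have h2 := hmax L ⟨le_rfl, by rw [hwL]; exact one_pos⟩
    have h3 := hpos L (by rw [hwL]; exact one_pos)
    have h4 : g L ≤ 1 := hg1 ▸ hmono _ _ (subset_univ L)
    have h5 : 1 ≤ (∑ v ∈ L, w v) / g L ^ 3 := by
      rw [hwL, le_div_iff₀ (by positivity), one_mul]
      exact pow_le_one₀ h3.le h4
    have h6 := h5.trans h2
    rwa [le_div_iff₀ (by positivity), one_mul] at h6
  refine ⟨Z, fun v hv => by simpa [hL] using hZ.1 hv, ?_, hgZ, fun Y hY => ?_⟩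
  · by_contra! hlt
    have h2 : g Z ^ 3 ≤ 1 / 2 := h1.trans hlt.le
    have h3 : g Z < 1 := by
      by_contra! h
      have := le_antisymm hgZ1 h
      rw [this] at h2
      norm_num at h2
    have h4 := h1.trans (hwg Z)
    have h5 : g Z ^ (3 * k + 11) = (g Z ^ 3) ^ k * g Z ^ 8 * g Z ^ 3 := by ring
    have h6 : (2 : ℝ) ^ k * (g Z ^ 3) ^ k ≤ 1 := by
      rw [← mul_pow]
      exact pow_le_one₀ (by positivity) (by linarith)
    have h7 : g Z ^ 8 < 1 := pow_lt_one₀ hgZ.le h3 (by norm_num)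
    have h8 : (0 : ℝ) < g Z ^ 3 := by positivity
    have h9 : (2 : ℝ) ^ k * g Z ^ (3 * k + 11) ≤ g Z ^ 8 * g Z ^ 3 := by
      rw [h5]
      calc (2 : ℝ) ^ k * ((g Z ^ 3) ^ k * g Z ^ 8 * g Z ^ 3)
          = ((2 : ℝ) ^ k * (g Z ^ 3) ^ k) * (g Z ^ 8 * g Z ^ 3) := by ring
        _ ≤ 1 * (g Z ^ 8 * g Z ^ 3) := mul_le_mul_of_nonneg_right h6 (by positivity)
        _ = _ := one_mul _
    nlinarith
  · rcases (sum_nonneg fun v (_ : v ∈ Y) => hw v).eq_or_lt with h | h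
    · rw [← h, zero_div]
      have := hg Y
      positivity
    · have h2 := hmax Y ⟨hY.trans hZ.1, h⟩
      have h3 := hpos Y h
      rw [div_le_div_iff₀ (by positivity) (by positivity)] at h2
      rw [div_pow, div_le_div_iff₀ hZ.2 (by positivity)]
      linarith

lemma controlled_comap [Fintype V] {G : SimpleGraph V} {w : V → ℝ} {g : Finset V → ℝ}
    (hw : ∀ v, 0 ≤ w v) (hg : ∀ X, 0 ≤ g X) (hmono : ∀ X Y, X ⊆ Y → g X ≤ g Y)
    (hadd : ∀ A B, Disjoint A B → (∀ a ∈ A, ∀ b ∈ B, ¬ G.Adj a b) → g A + g B ≤ g (A ∪ B))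
    {Z : Finset V} (hZ : 1 / 2 ≤ ∑ v ∈ Z, w v) (hgZ : 0 < g Z)
    (hZg : ∀ Y ⊆ Z, (∑ v ∈ Y, w v) / ∑ v ∈ Z, w v ≤ (g Y / g Z) ^ 3)
    (hdeg : ∀ v ∈ Z, w v + wdeg G.Adj w v ≤ 1 / 20) :
    Controlled (G.comap (Subtype.val : {v // v ∈ Z} → V)) (fun v => w v / ∑ v ∈ Z, w v)
      (fun Y => g (Y.map (Function.Embedding.subtype _)) / g Z) := by
  have hsub : ∀ Y : Finset {v // v ∈ Z}, Y.map (Function.Embedding.subtype _) ⊆ Z := by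
    intro Y v hv
    obtain ⟨u, -, rfl⟩ := mem_map.1 hv
    exact u.2
  have huniv : (univ : Finset {v // v ∈ Z}).map (Function.Embedding.subtype _) = Z := by
    ext v
    simp
  have hsum : ∀ Y : Finset {v // v ∈ Z}, ∑ v ∈ Y, w v / ∑ v ∈ Z, w v =
      (∑ v ∈ Y.map (Function.Embedding.subtype _), w v) / ∑ v ∈ Z, w v := by
    intro Y
    rw [sum_map, sum_div]
    rfl
  have hZpos : 0 < ∑ v ∈ Z, w v := by linarith
  refine ⟨fun v => div_nonneg (hw v) hZpos.le, ?_, fun Y => div_nonneg (hg _) hgZ.le,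
    fun X Y hXY => ?_, ?_, fun A B hAB h => ?_, fun Y => ?_, fun v => ?_⟩
  · rw [hsum, huniv, div_self hZpos.ne']
  · exact div_le_div_of_nonneg_right (hmono _ _ (map_subset_map.2 hXY)) hgZ.le
  · rw [huniv, div_self hgZ.ne']
  · have hu : ∀ U : Finset {v // v ∈ Z}, (∀ v, v ∈ U ↔ v ∈ A ∨ v ∈ B) →
        U.map (Function.Embedding.subtype _) =
        A.map (Function.Embedding.subtype _) ∪ B.map (Function.Embedding.subtype _) := by
      intro U hU
      ext v
      simp only [mem_map, mem_union, hU, or_and_right, exists_or]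
    rw [← add_div]
    refine div_le_div_of_nonneg_right
      ((hadd _ _ ((disjoint_map _).2 hAB) fun a ha b hb => ?_).trans_eq
        (congrArg g (hu _ (by simp only [mem_union, implies_true])).symm)) hgZ.le
    obtain ⟨a', ha', rfl⟩ := mem_map.1 ha
    obtain ⟨b', hb', rfl⟩ := mem_map.1 hb
    exact h a' ha' b' hb'
  · rw [hsum]
    exact hZg _ (hsub Y)
  · rw [hsum, div_le_iff₀ hZpos]
    refine le_trans (b := ∑ u ∈ insert v.1 (univ.filter fun b => G.Adj v.1 b), w u) ?_ ?_
    · refine sum_le_sum_of_subset_of_nonneg (fun u hu => ?_) fun u _ _ => hw u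
      obtain ⟨z, hz, rfl⟩ := mem_map.1 hu
      simp only [mem_filter, mem_univ, true_and] at hz
      rcases hz with rfl | h
      · exact mem_insert_self _ _
      · exact mem_insert_of_mem (mem_filter.2 ⟨mem_univ _, h⟩)
    · rw [sum_insert (by simp)]
      have := hdeg v.1 v.2
      unfold wdeg at this
      linarith

/-- In graphs with no hole with a hat, no probability measure is bounded by a large power of a
split-superadditive set function and has only small atoms. -/
theorem exists_no_measure : ∃ α : ℕ, 11 ≤ α ∧ ∀ {V : Type} [Fintype V] (G : SimpleGraph V),
    ¬ HasHoleWithHat G → ∀ (g : Finset V → ℝ), SplitSuperadditive G g → g univ = 1 →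
    ∀ μ : V → ℝ, (∀ v, 0 ≤ μ v) → ∑ v, μ v = 1 → (∀ Y, ∑ v ∈ Y, μ v ≤ g Y ^ α) →
    ¬ ∀ v, μ v ≤ (1 / 2) ^ α := by
  obtain ⟨δ, hδ, hmain⟩ := exists_measure_wdeg_le 5 (fun i j => i ≠ j + 1)
  obtain ⟨k, hk⟩ := pow_unbounded_of_one_lt (1 / δ) (one_lt_two (α := ℝ))
  refine ⟨3 * k + 11, by omega, fun {V} _ G hG g hg hg1 μ hμ hμ1 hμg hatom => ?_⟩
  obtain ⟨w, hw, hw1, hwμ, hdeg⟩ := hmain G μ hμ hμ1 fun h => hG (hasHoleWithHat_of_hasPattern h)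
  have hwk : ∀ v, w v ≤ 2 ^ k * μ v := by
    intro v
    have h1 : w v ≤ 1 / δ * μ v := by
      rw [one_div, ← div_eq_inv_mul, le_div_iff₀ hδ]
      linarith [hwμ v]
    exact h1.trans (mul_le_mul_of_nonneg_right hk.le (hμ v))
  have hwatom : ∀ v, w v ≤ 1 / 40 := by
    intro v
    have h1 : (2 : ℝ) ^ k * (1 / 2) ^ (3 * k + 11) = ((1 / 2) ^ k) ^ 2 * (1 / 2) ^ 11 := by
      have : (2 : ℝ) ^ k * (1 / 2) ^ k = 1 := by rw [← mul_pow]; norm_num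
      calc (2 : ℝ) ^ k * (1 / 2) ^ (3 * k + 11)
          = ((2 : ℝ) ^ k * (1 / 2) ^ k) * ((1 / 2) ^ k) ^ 2 * (1 / 2) ^ 11 := by ring
        _ = _ := by rw [this, one_mul]
    have h2 : ((1 / 2 : ℝ) ^ k) ^ 2 ≤ 1 :=
      pow_le_one₀ (by positivity) (pow_le_one₀ (by norm_num) (by norm_num))
    have h3 := (hwk v).trans (mul_le_mul_of_nonneg_left (hatom v) (by positivity))
    rw [h1] at h3
    norm_num at h3 h2 ⊢
    have h4 : ((1 / 2 : ℝ) ^ k) ^ 2 ≤ 1 := pow_le_one₀ (by positivity) h2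
    linarith
  obtain ⟨Z, hZ0, hZ, hgZ, hZg⟩ := exists_cube_bound hw hw1 hg.nonneg hg.mono hg1 (k := k) (by
    intro Y
    refine (sum_le_sum fun v _ => hwk v).trans ?_
    rw [← mul_sum]
    exact mul_le_mul_of_nonneg_left (hμg Y) (by positivity))
  have hG' : ¬ HasHoleWithHat (G.comap (Subtype.val : {v // v ∈ Z} → V)) :=
    fun h => hG h.of_comap
  rcases hdeg with hdeg | hdeg
  · refine (controlled_comap hw hg.nonneg hg.mono hg.add_anti hZ hgZ hZg fun v hv => ?_).false hG'
    linarith [hdeg v (hZ0 v hv), hwatom v]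
  · have hadd : ∀ A B, Disjoint A B → (∀ a ∈ A, ∀ b ∈ B, ¬ Gᶜ.Adj a b) →
        g A + g B ≤ g (A ∪ B) := by
      intro A B hAB h
      refine hg.add_complete A B hAB fun a ha b hb => by_contra fun hab => ?_
      exact h a ha b hb ⟨fun e => disjoint_left.1 hAB ha (e ▸ hb), hab⟩
    have hc := controlled_comap (G := Gᶜ) hw hg.nonneg hg.mono hadd hZ hgZ hZg fun v hv => by
      have : wdeg Gᶜ.Adj w v = wdeg (coAdj G) w v := by
        unfold wdeg
        refine sum_congr (by
          ext b
          simp only [mem_filter, mem_univ, true_and]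
          simp only [SimpleGraph.compl_adj, coAdj]
          exact and_congr_left' ne_comm) fun _ _ => rfl
      linarith [hdeg v (hZ0 v hv), hwatom v]
    have hcompl : Gᶜ.comap (Subtype.val : {v // v ∈ Z} → V) =
        (G.comap (Subtype.val : {v // v ∈ Z} → V))ᶜ := by
      ext a b
      simp only [SimpleGraph.comap_adj, SimpleGraph.compl_adj, ne_eq, Subtype.ext_iff]
    rw [hcompl] at hc
    exact hc.false_of_compl hG'

end Concentration

section Narrowness

open scoped Classical

/-- Every subset of `S` contains a clique whose size bounds the number of colours in some proper
colouring of that subset. -/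
def NicePerfect (G : SimpleGraph V) (S : Finset V) : Prop :=
  ∀ T ⊆ S, ∃ (k : ℕ) (c : V → ℕ) (K : Finset V), (∀ a ∈ T, c a < k) ∧
    (∀ a ∈ T, ∀ b ∈ T, G.Adj a b → c a ≠ c b) ∧ K ⊆ T ∧ (∀ a ∈ K, ∀ b ∈ K, a ≠ b → G.Adj a b) ∧
    K.card = k

lemma NicePerfect.isPerfect {G : SimpleGraph V} {S : Finset V} (h : NicePerfect G S)
    [Fintype (S : Set V)] : IsPerfect (G.induce (S : Set V)) := by
  intro S'
  obtain ⟨k, c, K, hc, hcol, hKT, hK, hk⟩ := h (S'.image Subtype.val) (by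
    intro v hv
    obtain ⟨u, -, rfl⟩ := mem_image.1 hv
    exact mem_coe.1 u.2)
  have hmem : ∀ x : (S' : Set (S : Set V)), x.1.1 ∈ S'.image Subtype.val :=
    fun x => mem_image_of_mem _ (mem_coe.1 x.2)
  refine le_antisymm ?_ SimpleGraph.cliqueNum_le_chromaticNumber
  have hcolor : ((G.induce (S : Set V)).induce (S' : Set (S : Set V))).Colorable k :=
    ⟨SimpleGraph.Coloring.mk (fun x => (⟨c x.1.1, hc _ (hmem x)⟩ : Fin k)) fun {x y} hxy e =>
      hcol _ (hmem x) _ (hmem y) hxy (congrArg Fin.val e)⟩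
  refine hcolor.chromaticNumber_le.trans (Nat.cast_le.2 ?_)
  have hclique : ((G.induce (S : Set V)).induce (S' : Set (S : Set V))).IsClique
      ((univ.filter fun x : (S' : Set (S : Set V)) => x.1.1 ∈ K : Finset _) : Set _) := by
    intro x hx y hy hxy
    simp only [coe_filter, mem_univ, true_and, Set.mem_ofPred_eq] at hx hy
    exact hK _ hx _ hy fun e => hxy (Subtype.ext (Subtype.ext e))
  refine le_trans (le_of_eq ?_) hclique.card_le_cliqueNum
  rw [← hk, ← card_image_of_injective _ (Subtype.val_injective.comp Subtype.val_injective)]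
  congr 1
  ext v
  simp only [mem_image, mem_filter, mem_univ, true_and, Function.comp]
  constructor
  · intro hv
    obtain ⟨u, hu, rfl⟩ := mem_image.1 (hKT hv)
    exact ⟨⟨u, hu⟩, hv, rfl⟩
  · rintro ⟨x, hx, rfl⟩
    exact hx

lemma nicePerfect_empty (G : SimpleGraph V) : NicePerfect G ∅ := by
  intro T hT
  obtain rfl := subset_empty.1 hT
  exact ⟨0, fun _ => 0, ∅, by simp⟩

lemma nicePerfect_singleton (G : SimpleGraph V) (v : V) : NicePerfect G {v} := by
  intro T hT
  rcases subset_singleton_iff.1 hT with rfl | rfl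
  · exact ⟨0, fun _ => 0, ∅, by simp⟩
  · exact ⟨1, fun _ => 0, {v}, by simp⟩

lemma NicePerfect.union_anticomplete {G : SimpleGraph V} {A B : Finset V} (hA : NicePerfect G A)
    (hB : NicePerfect G B) (hAB : ∀ a ∈ A, ∀ b ∈ B, ¬ G.Adj a b) : NicePerfect G (A ∪ B) := by
  intro T hT
  obtain ⟨k, c, K, hc, hcol, hKT, hK, hk⟩ := hA (T ∩ A) inter_subset_right
  obtain ⟨l, d, L, hd, hdol, hLT, hL, hl⟩ := hB (T ∩ B) inter_subset_right
  simp only [mem_inter, and_imp] at hc hcol hd hdol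
  have hTB : ∀ a ∈ T, a ∉ A → a ∈ B := fun a ha h => (mem_union.1 (hT ha)).resolve_left h
  refine ⟨max k l, fun v => if v ∈ A then c v else d v, if l ≤ k then K else L, ?_, ?_, ?_, ?_, ?_⟩
  · intro a ha
    by_cases h : a ∈ A
    · simpa [h] using Or.inl (hc a ha h)
    · simpa [h] using Or.inr (hd a ha (hTB a ha h))
  · intro a ha b hb hab
    by_cases h : a ∈ A <;> by_cases h' : b ∈ A <;> simp only [h, h', if_true, if_false]
    · exact hcol a ha h b hb h' hab
    · exact absurd hab (hAB a h b (hTB b hb h'))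
    · exact absurd hab.symm (hAB b h' a (hTB a ha h))
    · exact hdol a ha (hTB a ha h) b hb (hTB b hb h') hab
  · split_ifs
    · exact hKT.trans inter_subset_left
    · exact hLT.trans inter_subset_left
  · split_ifs
    · exact hK
    · exact hL
  · split_ifs <;> omega

lemma NicePerfect.union_complete {G : SimpleGraph V} {A B : Finset V} (hA : NicePerfect G A)
    (hB : NicePerfect G B) (hAB : ∀ a ∈ A, ∀ b ∈ B, G.Adj a b) : NicePerfect G (A ∪ B) := by
  intro T hT
  obtain ⟨k, c, K, hc, hcol, hKT, hK, hk⟩ := hA (T ∩ A) inter_subset_right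
  obtain ⟨l, d, L, hd, hdol, hLT, hL, hl⟩ := hB (T ∩ B) inter_subset_right
  simp only [mem_inter, and_imp] at hc hcol hd hdol
  have hTB : ∀ a ∈ T, a ∉ A → a ∈ B := fun a ha h => (mem_union.1 (hT ha)).resolve_left h
  have hKA : ∀ a ∈ K, a ∈ A := fun a ha => (mem_inter.1 (hKT ha)).2
  have hLB : ∀ a ∈ L, a ∈ B := fun a ha => (mem_inter.1 (hLT ha)).2
  refine ⟨k + l, fun v => if v ∈ A then c v else k + d v, K ∪ L, ?_, ?_, ?_, ?_, ?_⟩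
  · intro a ha
    by_cases h : a ∈ A
    · simpa [h] using (hc a ha h).trans_le (Nat.le_add_right k l)
    · simpa [h] using hd a ha (hTB a ha h)
  · intro a ha b hb hab
    by_cases h : a ∈ A <;> by_cases h' : b ∈ A <;> simp only [h, h', if_true, if_false]
    · exact hcol a ha h b hb h' hab
    · have := hc a ha h
      omega
    · have := hc b hb h'
      omega
    · have := hdol a ha (hTB a ha h) b hb (hTB b hb h') hab
      omega
  · exact union_subset (hKT.trans inter_subset_left) (hLT.trans inter_subset_left)
  · intro a ha b hb hab
    rcases mem_union.1 ha with ha | ha <;> rcases mem_union.1 hb with hb | hb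
    · exact hK a ha b hb hab
    · exact hAB a (hKA a ha) b (hLB b hb)
    · exact (hAB b (hKA b hb) a (hLB a ha)).symm
    · exact hL a ha b hb hab
  · rw [card_union_of_disjoint, hk, hl]
    exact disjoint_left.2 fun a ha hb => (hAB a (hKA a ha) a (hLB a hb)).ne rfl

/-- The largest `f`-weight of a nice perfect subset of `X`. -/
noncomputable def perfectWeight (G : SimpleGraph V) (f : V → ℝ) (X : Finset V) : ℝ :=
  (X.powerset.filter (NicePerfect G)).sup'
    ⟨∅, mem_filter.2 ⟨empty_mem_powerset _, nicePerfect_empty G⟩⟩ fun P => ∑ v ∈ P, f v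

lemma le_perfectWeight {G : SimpleGraph V} {f : V → ℝ} {X P : Finset V} (hP : P ⊆ X)
    (h : NicePerfect G P) : ∑ v ∈ P, f v ≤ perfectWeight G f X :=
  le_sup' (fun P => ∑ v ∈ P, f v) (mem_filter.2 ⟨mem_powerset.2 hP, h⟩)

lemma exists_eq_perfectWeight (G : SimpleGraph V) (f : V → ℝ) (X : Finset V) :
    ∃ P ⊆ X, NicePerfect G P ∧ perfectWeight G f X = ∑ v ∈ P, f v := by
  obtain ⟨P, hP, h⟩ := exists_mem_eq_sup' (s := X.powerset.filter (NicePerfect G))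
    ⟨∅, mem_filter.2 ⟨empty_mem_powerset _, nicePerfect_empty G⟩⟩ fun P => ∑ v ∈ P, f v
  obtain ⟨hPX, hP⟩ := mem_filter.1 hP
  exact ⟨P, mem_powerset.1 hPX, hP, h⟩

lemma splitSuperadditive_perfectWeight (G : SimpleGraph V) (f : V → ℝ) :
    SplitSuperadditive G (perfectWeight G f) := by
  refine ⟨fun X => ?_, fun X Y hXY => ?_, fun A B hd h => ?_, fun A B hd h => ?_⟩
  · simpa using le_perfectWeight (f := f) (empty_subset X) (nicePerfect_empty G)
  · obtain ⟨P, hP, hn, e⟩ := exists_eq_perfectWeight G f X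
    exact e ▸ le_perfectWeight (hP.trans hXY) hn
  all_goals
    obtain ⟨P, hP, hn, e⟩ := exists_eq_perfectWeight G f A
    obtain ⟨Q, hQ, hm, e'⟩ := exists_eq_perfectWeight G f B
    rw [e, e', ← sum_union (disjoint_of_subset_left hP (disjoint_of_subset_right hQ hd))]
    refine le_perfectWeight (union_subset_union hP hQ) ?_
  · exact hn.union_anticomplete hm fun a ha b hb => h a (hP ha) b (hQ hb)
  · exact hn.union_complete hm fun a ha b hb => h a (hP ha) b (hQ hb)

lemma perfectWeight_univ_le_one [Fintype V] {G : SimpleGraph V} {f : V → ℝ} (hf : GoodOn G f) :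
    perfectWeight G f univ ≤ 1 := by
  obtain ⟨P, -, hn, e⟩ := exists_eq_perfectWeight G f univ
  exact e ▸ hf.2 P hn.isPerfect

lemma SplitSuperadditive.restrict [Fintype V] {G : SimpleGraph V} {g : Finset V → ℝ}
    (h : SplitSuperadditive G g) (X : Finset V) (hX : 0 < g X) :
    SplitSuperadditive G fun Y => g (Y ∩ X) / g X := by
  have hsub : ∀ A B : Finset V, Disjoint A B → Disjoint (A ∩ X) (B ∩ X) := fun A B hd =>
    disjoint_of_subset_left inter_subset_left (disjoint_of_subset_right inter_subset_left hd)
  refine ⟨fun Y => div_nonneg (h.nonneg _) hX.le,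
    fun Y Z hYZ => div_le_div_of_nonneg_right (h.mono _ _ (inter_subset_inter_right hYZ)) hX.le,
    fun A B hd hAB => ?_, fun A B hd hAB => ?_⟩ <;>
    rw [← add_div, union_inter_distrib_right] <;> refine div_le_div_of_nonneg_right ?_ hX.le
  · exact h.add_anti _ _ (hsub A B hd) fun a ha b hb =>
      hAB a (mem_inter.1 ha).1 b (mem_inter.1 hb).1
  · exact h.add_complete _ _ (hsub A B hd) fun a ha b hb =>
      hAB a (mem_inter.1 ha).1 b (mem_inter.1 hb).1

/-- A vertex carrying at least half of `g X` cannot violate the power bound on `X`, provided the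
bound holds on its neighbourhood and its non-neighbourhood. -/
lemma SplitSuperadditive.sum_pow_le_of_heavy {G : SimpleGraph V} {g : Finset V → ℝ}
    (h : SplitSuperadditive G g) {f : V → ℝ} (hf : ∀ v, 0 ≤ f v) (hfg : ∀ v, f v ≤ g {v})
    {α : ℕ} (hα : 2 ≤ α) {X : Finset V} {v : V} (hv : v ∈ X) (hhalf : g X / 2 ≤ f v)
    (ih : ∀ Y ⊂ X, ∑ u ∈ Y, f u ^ α ≤ g Y ^ α) : ∑ u ∈ X, f u ^ α ≤ g X ^ α := by
  set A := X.filter fun u => G.Adj v u with hA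
  set B := (X.erase v).filter fun u => ¬ G.Adj v u with hB
  have hvA : v ∉ A := by simp [hA]
  have hvB : v ∉ B := by simp [hB]
  have hAX : A ⊂ X := Finset.ssubset_iff_subset_ne.2 ⟨filter_subset _ _, fun e => hvA (e ▸ hv)⟩
  have hBX : B ⊂ X := Finset.ssubset_iff_subset_ne.2
    ⟨(filter_subset _ _).trans (erase_subset _ _), fun e => hvB (e ▸ hv)⟩
  have hgA : f v + g A ≤ g X := by
    refine (add_le_add_left (hfg v) _).trans ((h.add_complete {v} A (by simpa) ?_).trans
      (h.mono _ _ (union_subset (by simpa) hAX.1)))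
    intro a ha b hb
    obtain rfl := mem_singleton.1 ha
    exact (mem_filter.1 hb).2
  have hgB : f v + g B ≤ g X := by
    refine (add_le_add_left (hfg v) _).trans ((h.add_anti {v} B (by simpa) ?_).trans
      (h.mono _ _ (union_subset (by simpa) hBX.1)))
    intro a ha b hb
    obtain rfl := mem_singleton.1 ha
    exact (mem_filter.1 hb).2
  have hsplit : ∑ u ∈ X, f u ^ α = f v ^ α + (∑ u ∈ A, f u ^ α + ∑ u ∈ B, f u ^ α) := by
    have hA' : A = (X.erase v).filter fun u => G.Adj v u := by
      ext u
      simp only [hA, mem_filter, mem_erase]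
      exact ⟨fun ⟨hu, hvu⟩ => ⟨⟨hvu.ne', hu⟩, hvu⟩, fun ⟨⟨_, hu⟩, hvu⟩ => ⟨hu, hvu⟩⟩
    rw [hA', hB, sum_filter_add_sum_filter_not, add_sum_erase X (fun u => f u ^ α) hv]
  set t := g X - f v with ht
  have ht0 : 0 ≤ t := by linarith [h.nonneg A]
  have hFA : ∑ u ∈ A, f u ^ α ≤ t ^ α :=
    (ih A hAX).trans (pow_le_pow_left₀ (h.nonneg A) (by linarith) α)
  have hFB : ∑ u ∈ B, f u ^ α ≤ t ^ α :=
    (ih B hBX).trans (pow_le_pow_left₀ (h.nonneg B) (by linarith) α)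
  obtain ⟨m, rfl⟩ := Nat.exists_eq_add_of_le hα
  have htf : t ≤ f v := by linarith
  have hgX : g X = f v + t := by simp [ht]
  have hm : f v ^ m ≤ (f v + t) ^ m := pow_le_pow_left₀ (hf v) (by linarith) m
  have hm' : t ^ m ≤ f v ^ m := pow_le_pow_left₀ ht0 htf m
  have hm0 : 0 ≤ f v ^ m := pow_nonneg (hf v) m
  have key : f v ^ (2 + m) + 2 * t ^ (2 + m) ≤ (f v + t) ^ (2 + m) := by
    calc f v ^ (2 + m) + 2 * t ^ (2 + m) = f v ^ 2 * f v ^ m + 2 * t ^ 2 * t ^ m := by ring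
      _ ≤ f v ^ 2 * f v ^ m + 2 * t ^ 2 * f v ^ m := by gcongr
      _ = (f v ^ 2 + 2 * t ^ 2) * f v ^ m := by ring
      _ ≤ (f v + t) ^ 2 * (f v + t) ^ m :=
        mul_le_mul (by nlinarith) hm hm0 (sq_nonneg _)
      _ = _ := by ring
  rw [hsplit, hgX]
  linarith

theorem exists_sum_pow_le : ∃ α : ℕ, 11 ≤ α ∧ ∀ {V : Type} [Fintype V] (G : SimpleGraph V),
    ¬ HasHoleWithHat G → ∀ (g : Finset V → ℝ), SplitSuperadditive G g →
    ∀ f : V → ℝ, (∀ v, 0 ≤ f v) → (∀ v, f v ≤ g {v}) →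
    ∀ X : Finset V, ∑ v ∈ X, f v ^ α ≤ g X ^ α := by
  obtain ⟨α, hα, hno⟩ := exists_no_measure
  refine ⟨α, hα, fun {V} _ G hG g hg f hf hfg X => ?_⟩
  induction X using Finset.strongInduction with
  | H X ih =>
  by_contra! hlt
  have hfX : ∀ v ∈ X, f v ≤ g X := fun v hv =>
    (hfg v).trans (hg.mono _ _ (singleton_subset_iff.2 hv))
  have hgX : 0 < g X := by
    refine (hg.nonneg X).lt_of_ne' fun h0 => ?_
    rw [h0, zero_pow (by omega)] at hlt
    refine hlt.not_ge (sum_nonpos fun v hv => ?_)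
    rw [le_antisymm (h0 ▸ hfX v hv) (hf v), zero_pow (by omega)]
  have hpow : 0 < g X ^ α := pow_pos hgX α
  have hF : 0 < ∑ v ∈ X, f v ^ α := hpow.trans hlt
  have hsum : ∀ Y : Finset V, ∑ v ∈ Y, (if v ∈ X then f v ^ α / ∑ v ∈ X, f v ^ α else 0) =
      (∑ v ∈ Y ∩ X, f v ^ α) / ∑ v ∈ X, f v ^ α := by
    intro Y
    rw [← sum_filter, filter_mem_eq_inter, sum_div]
  refine hno G hG _ (hg.restrict X hgX) (by simp [hgX.ne'])
    (fun v => if v ∈ X then f v ^ α / ∑ v ∈ X, f v ^ α else 0) (fun v => ?_) ?_ (fun Y => ?_)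
    fun v => ?_
  · split_ifs
    · exact div_nonneg (pow_nonneg (hf v) α) hF.le
    · exact le_rfl
  · rw [hsum, univ_inter, div_self hF.ne']
  · rw [hsum, div_pow]
    by_cases hY : Y ∩ X = X
    · rw [hY, div_self hF.ne', div_self hpow.ne']
    · exact div_le_div₀ (pow_nonneg (hg.nonneg _) α)
        (ih _ (Finset.ssubset_iff_subset_ne.2 ⟨inter_subset_right, hY⟩)) hpow hlt.le
  · split_ifs with hv
    · have hlight : f v < g X / 2 := by
        by_contra! hhalf
        exact hlt.not_ge (hg.sum_pow_le_of_heavy hf hfg (by omega) hv hhalf ih)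
      calc f v ^ α / ∑ v ∈ X, f v ^ α ≤ (g X / 2) ^ α / g X ^ α :=
            div_le_div₀ (by positivity) (pow_le_pow_left₀ (hf v) hlight.le α) hpow hlt.le
        _ = (1 / 2) ^ α := by
            rw [← div_pow]
            congr 1
            field_simp
    · positivity

end Narrowness
theorem statement_2 :
    ∃ α : ℝ, 1 ≤ α ∧ ∀ (V : Type) [Fintype V] (G : SimpleGraph V),
      HoleWithHatFree G → Narrow G α := by
  obtain ⟨α, hα, h⟩ := exists_sum_pow_le
  refine ⟨α, by exact_mod_cast (by omega : 1 ≤ α), fun V _ G hG f hf => ?_⟩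
  have hg := splitSuperadditive_perfectWeight G f
  simp only [Real.rpow_natCast]
  refine (h G hG _ hg f hf.1 (fun v => ?_) univ).trans
    (pow_le_one₀ (hg.nonneg _) (perfectWeight_univ_le_one hf))
  simpa using le_perfectWeight (f := f) subset_rfl (nicePerfect_singleton G v)

end EHhat
end

section
/- Let α' ≥ 1 be such that every forcer-free graph is α'-narrow. Let α ≥ α', and let G be a graph such that every proper induced subgraph of G is α-narrow. Let g be a good function on G. Let Z ⊆ V(G) with |Z| > 1, such that G[Z] is connected and guarded. Let d be the maximum over all v ∈ Z of Σ_{u∈N_G(v)∩Z} (g(u))^α. Then Σ_{v∈Z} (g(v))^α ≤ max(2d, d^{1−α'/α}). -/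
open Finset

namespace EHhat

variable {V : Type*}

/-- A combinatorial reformulation of the perfection of `G.induce S`: every `T ⊆ S` all of whose
cliques have size at most `k` can be properly coloured with `k` colours. -/
def PerfectOn (G : SimpleGraph V) (S : Finset V) : Prop :=
  ∀ T ⊆ S, ∀ k : ℕ, (∀ K ⊆ T, G.IsClique (K : Set V) → K.card ≤ k) →
    ∃ c : V → ℕ, (∀ v ∈ T, c v < k) ∧ ∀ u ∈ T, ∀ v ∈ T, G.Adj u v → c u ≠ c v

theorem PerfectOn.mono {G : SimpleGraph V} {S T : Finset V} (h : PerfectOn G S) (hT : T ⊆ S) :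
    PerfectOn G T :=
  fun T' hT' => h T' (hT'.trans hT)

theorem perfectOn_singleton (G : SimpleGraph V) (v : V) : PerfectOn G {v} := by
  intro T hT k hk
  refine ⟨fun _ => 0, fun u hu => ?_, fun u hu w hw huw => ?_⟩
  · have := hk {u} (by simpa using hu) (by simp)
    rwa [Finset.card_singleton] at this
  · have h1 := Finset.mem_singleton.1 (hT hu)
    have h2 := Finset.mem_singleton.1 (hT hw)
    subst h1 h2
    exact absurd huw (G.irrefl)

theorem PerfectOn.map {W : Type*} {G : SimpleGraph V} {H : SimpleGraph W} (e : G ↪g H)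
    {S : Finset V} (h : PerfectOn G S) : PerfectOn H (S.map e.toEmbedding) := by
  classical
  intro T hT k hk
  obtain ⟨T', hT', rfl⟩ := Finset.subset_map_iff.1 hT
  obtain ⟨c, hc1, hc2⟩ := h T' hT' k (fun K hK hcl => by
    have := hk (K.map e.toEmbedding) (Finset.map_subset_map.2 hK) (by
      intro x hx y hy hxy
      simp only [Finset.coe_map, Set.mem_image, Finset.mem_coe] at hx hy
      obtain ⟨a, ha, rfl⟩ := hx
      obtain ⟨b, hb, rfl⟩ := hy
      exact e.map_adj_iff.2 (hcl ha hb (fun hab => hxy (by rw [hab]))))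
    simpa using this)
  refine ⟨Function.extend e c 0, ?_, ?_⟩
  · intro v hv
    obtain ⟨a, ha, rfl⟩ := Finset.mem_map.1 hv
    have : Function.extend e c 0 (e a) = c a := e.injective.extend_apply _ _ _
    exact this.trans_lt (hc1 a ha)
  · intro u hu v hv huv
    obtain ⟨a, ha, rfl⟩ := Finset.mem_map.1 hu
    obtain ⟨b, hb, rfl⟩ := Finset.mem_map.1 hv
    have h1 : Function.extend e c 0 (e a) = c a := e.injective.extend_apply _ _ _
    have h2 : Function.extend e c 0 (e b) = c b := e.injective.extend_apply _ _ _
    change Function.extend e c 0 (e a) ≠ Function.extend e c 0 (e b)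
    rw [h1, h2]
    exact hc2 a ha b hb (e.map_adj_iff.1 huv)

theorem colorable_induce_iff (G : SimpleGraph V) (T : Finset V) (k : ℕ) :
    (G.induce (T : Set V)).Colorable k ↔
      ∃ c : V → ℕ, (∀ v ∈ T, c v < k) ∧ ∀ u ∈ T, ∀ v ∈ T, G.Adj u v → c u ≠ c v := by
  classical
  constructor
  · rintro ⟨C⟩
    refine ⟨fun v => if hv : v ∈ T then (C ⟨v, hv⟩).1 else 0, fun v hv => ?_,
      fun u hu v hv huv => ?_⟩
    · simp [hv]
    · simp only [hu, hv, dite_true]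
      intro h
      exact C.valid (v := ⟨u, hu⟩) (w := ⟨v, hv⟩) huv (Fin.ext h)
  · rintro ⟨c, h1, h2⟩
    exact ⟨SimpleGraph.Coloring.mk (fun v => ⟨c v, h1 v v.2⟩) (fun {u v} huv h =>
      h2 u u.2 v v.2 huv (Fin.ext_iff.1 h))⟩

theorem isPerfect_iff_perfectOn [Fintype V] (G : SimpleGraph V) :
    IsPerfect G ↔ PerfectOn G Finset.univ := by
  classical
  constructor
  · intro h T _ k hk
    rw [← colorable_induce_iff, ← SimpleGraph.chromaticNumber_le_iff_colorable, h T]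
    obtain ⟨s, hs⟩ := (G.induce (T : Set V)).exists_isNClique_cliqueNum
    have := hk (s.map (Function.Embedding.subtype _)) (by
      intro x hx
      obtain ⟨a, -, rfl⟩ := Finset.mem_map.1 hx
      exact a.2) (by
      intro x hx y hy hxy
      simp only [Finset.coe_map, Set.mem_image, Finset.mem_coe] at hx hy
      obtain ⟨a, ha, rfl⟩ := hx
      obtain ⟨b, hb, rfl⟩ := hy
      exact hs.isClique ha hb (fun hab => hxy (by rw [hab])))
    rw [Finset.card_map, hs.card_eq] at this
    exact_mod_cast this
  · intro h T
    refine le_antisymm ?_ (SimpleGraph.cliqueNum_le_chromaticNumber)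
    rw [SimpleGraph.chromaticNumber_le_iff_colorable, colorable_induce_iff]
    refine h T (Finset.subset_univ _) _ (fun K hK hcl => ?_)
    have : (G.induce (T : Set V)).IsClique
        ((K.subtype (fun v => v ∈ T) : Finset {v // v ∈ T}) : Set {v // v ∈ T}) := by
      intro x hx y hy hxy
      simp only [Finset.mem_coe, Finset.mem_subtype] at hx hy
      exact hcl hx hy (fun hab => hxy (Subtype.ext hab))
    have h2 := this.card_le_cliqueNum
    rwa [Finset.card_subtype, Finset.filter_true_of_mem (fun x hx => hK hx)] at h2

theorem PerfectOn.of_map {W : Type*} {G : SimpleGraph V} {H : SimpleGraph W} (e : G ↪g H)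
    {S : Finset V} (h : PerfectOn H (S.map e.toEmbedding)) : PerfectOn G S := by
  classical
  intro T hT k hk
  obtain ⟨c, h1, h2⟩ := h (T.map e.toEmbedding) (Finset.map_subset_map.2 hT) k (by
    intro K hK hcl
    obtain ⟨K', hK', rfl⟩ := Finset.subset_map_iff.1 hK
    rw [Finset.card_map]
    refine hk K' hK' (fun x hx y hy hxy => e.map_adj_iff.1 ?_)
    exact hcl (Finset.mem_map_of_mem _ hx) (Finset.mem_map_of_mem _ hy)
      (fun h => hxy (e.injective h)))
  exact ⟨fun v => c (e v), fun v hv => h1 _ (Finset.mem_map_of_mem _ hv),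
    fun u hu v hv huv => h2 _ (Finset.mem_map_of_mem _ hu) _ (Finset.mem_map_of_mem _ hv)
      (e.map_adj_iff.2 huv)⟩

theorem isPerfect_induce_iff_perfectOn [Fintype V] {G : SimpleGraph V} {S : Finset V} :
    IsPerfect (G.induce (S : Set V)) ↔ PerfectOn G S := by
  rw [isPerfect_iff_perfectOn]
  have hmap : (Finset.univ : Finset (S : Set V)).map
      (SimpleGraph.Embedding.induce (G := G) (S : Set V)).toEmbedding = S := by
    ext v
    simp
  exact ⟨fun h => hmap ▸ h.map (SimpleGraph.Embedding.induce _),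
    fun h => PerfectOn.of_map (SimpleGraph.Embedding.induce _) (hmap.symm ▸ h)⟩

/-- The weighted form of the replication lemma for perfect graphs. -/
theorem PerfectOn.exists_weighted_coloring {G : SimpleGraph V} {S : Finset V}
    (hS : PerfectOn G S) (w : V → ℕ) (k : ℕ)
    (hk : ∀ K ⊆ S, G.IsClique (K : Set V) → ∑ v ∈ K, w v ≤ k) :
    ∃ C : V → Finset ℕ, (∀ v ∈ S, C v ⊆ Finset.range k ∧ (C v).card = w v) ∧
      ∀ u ∈ S, ∀ v ∈ S, G.Adj u v → Disjoint (C u) (C v) := by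
  classical
  induction hn : ∑ v ∈ S, w v using Nat.strong_induction_on generalizing w k with
  | _ n ih =>
  by_cases hw : ∀ v ∈ S, w v ≤ 1
  · obtain ⟨c, hc1, hc2⟩ := hS (S.filter (fun v => w v = 1)) (Finset.filter_subset _ _) k (by
      intro K hK hcl
      have := hk K (hK.trans (Finset.filter_subset _ _)) hcl
      rwa [Finset.sum_congr rfl (fun v hv => (Finset.mem_filter.1 (hK hv)).2),
        Finset.sum_const, smul_eq_mul, mul_one] at this)
    refine ⟨fun v => if w v = 1 then {c v} else ∅, fun v hv => ?_, fun u hu v hv huv => ?_⟩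
    · dsimp only
      split_ifs with h
      · simpa [h] using hc1 v (by simp [hv, h])
      · have := hw v hv
        simp only [Finset.empty_subset, Finset.card_empty, true_and]
        omega
    · dsimp only
      split_ifs with h1 h2 <;> simp
      exact hc2 u (by simp [hu, h1]) v (by simp [hv, h2]) huv
  · push Not at hw
    obtain ⟨i, hi, hwi⟩ := hw
    have hk1 : 1 ≤ k := by
      have := hk {i} (by simpa using hi) (by simp)
      rw [Finset.sum_singleton] at this
      omega
    let w' : V → ℕ := fun v => if v = i then w v - 1 else w v
    have hw'le : ∀ v, w' v ≤ w v := by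
      intro v; simp only [w']; split_ifs <;> omega
    have hw'lt : ∀ K : Finset V, i ∈ K → ∑ v ∈ K, w' v < ∑ v ∈ K, w v := fun K hK =>
      Finset.sum_lt_sum (fun v _ => hw'le v) ⟨i, hK, by simp only [w', if_true]; omega⟩
    obtain ⟨C, hC1, hC2⟩ := ih _ (hn ▸ hw'lt S hi) w' k (fun K hK hcl =>
      (Finset.sum_le_sum fun v _ => hw'le v).trans (hk K hK hcl)) rfl
    have hne : (C i).Nonempty := by
      rw [← Finset.card_pos, (hC1 i hi).2]
      simp only [w', if_true]; omega
    obtain ⟨c, hc⟩ := hne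
    let w'' : V → ℕ := fun v => if c ∈ C v then w v - 1 else w v
    have hw''le : ∀ v, w'' v ≤ w' v := by
      intro v
      simp only [w'', w']
      split_ifs with h1 h2 h2
      · omega
      · omega
      · exact absurd (h2 ▸ hc) h1
      · omega
    have hpos : ∀ v ∈ S, c ∈ C v → 1 ≤ w v := by
      intro v hv hcv
      have h1 : 0 < (C v).card := Finset.card_pos.2 ⟨c, hcv⟩
      have h2 := hw'le v
      rw [(hC1 v hv).2] at h1
      omega
    obtain ⟨D, hD1, hD2⟩ := ih _
      (hn ▸ (Finset.sum_le_sum fun v _ => hw''le v).trans_lt (hw'lt S hi)) w'' (k - 1) (by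
        intro K hK hcl
        have hKw := hk K hK hcl
        by_cases hiK : i ∈ K
        · have h1 := hw'lt K hiK
          have h2 : ∑ v ∈ K, w'' v ≤ ∑ v ∈ K, w' v := Finset.sum_le_sum fun v _ => hw''le v
          omega
        · by_cases hcK : ∃ j ∈ K, c ∈ C j
          · obtain ⟨j, hj, hcj⟩ := hcK
            have : ∑ v ∈ K, w'' v < ∑ v ∈ K, w v := by
              refine Finset.sum_lt_sum (fun v _ => (hw''le v).trans (hw'le v)) ⟨j, hj, ?_⟩
              have := hpos j (hK hj) hcj
              simp only [w'', hcj, if_true]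
              omega
            omega
          · push Not at hcK
            have hcard : (K.biUnion C).card = ∑ v ∈ K, w' v := by
              rw [Finset.card_biUnion]
              · exact Finset.sum_congr rfl fun v hv => (hC1 v (hK hv)).2
              · intro u hu v hv huv
                exact hC2 u (hK hu) v (hK hv) (hcl hu hv huv)
            have hsub : K.biUnion C ⊆ (Finset.range k).erase c := by
              intro x hx
              obtain ⟨v, hv, hxv⟩ := Finset.mem_biUnion.1 hx
              exact Finset.mem_erase.2 ⟨fun h => hcK v hv (h ▸ hxv), (hC1 v (hK hv)).1 hxv⟩
            have h1 := Finset.card_le_card hsub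
            rw [hcard, Finset.card_erase_of_mem ((hC1 i hi).1 hc), Finset.card_range] at h1
            exact (Finset.sum_le_sum fun v _ => hw''le v).trans h1) rfl
    have hnot : ∀ v ∈ S, k - 1 ∉ D v := fun v hv h => by
      have := Finset.mem_range.1 ((hD1 v hv).1 h)
      omega
    refine ⟨fun v => if c ∈ C v then insert (k - 1) (D v) else D v, fun v hv => ?_,
      fun u hu v hv huv => ?_⟩
    · have hsub : D v ⊆ Finset.range k :=
        (hD1 v hv).1.trans (Finset.range_subset_range.2 (Nat.sub_le _ _))
      dsimp only
      split_ifs with h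
      · refine ⟨Finset.insert_subset (by simp; omega) hsub, ?_⟩
        have := hpos v hv h
        rw [Finset.card_insert_of_notMem (hnot v hv), (hD1 v hv).2]
        simp only [w'', h, if_true]
        omega
      · refine ⟨hsub, ?_⟩
        rw [(hD1 v hv).2]
        simp only [w'', h, if_false]
    · have hd := hD2 u hu v hv huv
      dsimp only
      split_ifs with h1 h2 h2
      · exact absurd h2 (Finset.disjoint_left.1 (hC2 u hu v hv huv) h1)
      · exact Finset.disjoint_insert_left.2 ⟨hnot v hv, hd⟩
      · exact Finset.disjoint_insert_right.2 ⟨hnot u hu, hd⟩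
      · exact hd

theorem exists_injOn_lt_card (s : Finset ℕ) :
    ∃ e : ℕ → ℕ, (∀ n < s.card, e n ∈ s) ∧ ∀ m < s.card, ∀ n < s.card, e m = e n → m = n := by
  refine ⟨fun n => if h : n < s.card then s.equivFin.symm ⟨n, h⟩ else 0, fun n hn => ?_,
    fun m hm n hn h => ?_⟩
  · simp [hn]
  · simpa [hm, hn] using h

/-- Lovász's substitution lemma: substituting perfect graphs for the vertices of a perfect graph
gives a perfect graph. -/
theorem PerfectOn.substitution {I : Type*} [DecidableEq I] {G : SimpleGraph V}
    {H : SimpleGraph I} (r : V → I)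
    (hr : ∀ u v, r u ≠ r v → (G.Adj u v ↔ H.Adj (r u) (r v))) {Q : Finset I}
    (hQ : PerfectOn H Q) {U : Finset V} (hUQ : ∀ u ∈ U, r u ∈ Q)
    (hU : ∀ i ∈ Q, PerfectOn G (U.filter (fun v => r v = i))) : PerfectOn G U := by
  classical
  intro T hT k hk
  have hmax : ∀ i : I, ∃ K ⊆ T.filter (fun v => r v = i), G.IsClique (K : Set V) ∧
      ∀ K' ⊆ T.filter (fun v => r v = i), G.IsClique (K' : Set V) → K'.card ≤ K.card := by
    intro i
    obtain ⟨K, hK, hKmax⟩ := Finset.exists_max_image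
      ((T.filter (fun v => r v = i)).powerset.filter (fun K : Finset V => G.IsClique (K : Set V)))
      Finset.card ⟨∅, by simp⟩
    simp only [Finset.mem_filter, Finset.mem_powerset] at hK hKmax
    exact ⟨K, hK.1, hK.2, fun K' h1 h2 => hKmax K' ⟨h1, h2⟩⟩
  choose K hK hKcl hKmax using hmax
  have hKr : ∀ i, ∀ v ∈ K i, r v = i := fun i v hv => (Finset.mem_filter.1 (hK i hv)).2
  obtain ⟨C, hC1, hC2⟩ := hQ.exists_weighted_coloring (fun i => (K i).card) k (by
    intro J _ hJ
    rw [← Finset.card_biUnion]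
    · refine hk _ ?_ ?_
      · intro x hx
        obtain ⟨i, -, hxi⟩ := Finset.mem_biUnion.1 hx
        exact (Finset.mem_filter.1 (hK i hxi)).1
      · intro x hx y hy hxy
        obtain ⟨i, hi, hxi⟩ := Finset.mem_biUnion.1 (Finset.mem_coe.1 hx)
        obtain ⟨j, hj, hyj⟩ := Finset.mem_biUnion.1 (Finset.mem_coe.1 hy)
        by_cases hij : i = j
        · subst hij
          exact hKcl i hxi hyj hxy
        · have h1 := hKr i x hxi
          have h2 := hKr j y hyj
          rw [hr x y (by rw [h1, h2]; exact hij), h1, h2]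
          exact hJ hi hj hij
    · intro i _ j _ hij
      exact Finset.disjoint_left.2 fun x hx hy => hij ((hKr i x hx).symm.trans (hKr j x hy)))
  have hcol : ∀ i ∈ Q, ∃ c : V → ℕ, (∀ v ∈ T.filter (fun v => r v = i), c v < (K i).card) ∧
      ∀ u ∈ T.filter (fun v => r v = i), ∀ v ∈ T.filter (fun v => r v = i),
        G.Adj u v → c u ≠ c v :=
    fun i hi => hU i hi _ (Finset.filter_subset_filter _ hT) _ (hKmax i)
  choose! c hc1 hc2 using hcol
  choose e he1 he2 using exists_injOn_lt_card
  have hlt : ∀ v ∈ T, c (r v) v < (C (r v)).card := fun v hv => by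
    rw [(hC1 _ (hUQ v (hT hv))).2]
    exact hc1 _ (hUQ v (hT hv)) v (by simp [hv])
  refine ⟨fun v => e (C (r v)) (c (r v) v), fun v hv => ?_, fun u hu v hv huv h => ?_⟩
  · exact Finset.mem_range.1 ((hC1 _ (hUQ v (hT hv))).1 (he1 _ _ (hlt v hv)))
  · dsimp only at h
    by_cases huv' : r u = r v
    · have h1 := hlt u hu
      rw [huv'] at h h1
      exact hc2 _ (hUQ v (hT hv)) u (by simp [hu, huv']) v (by simp [hv]) huv
        (he2 _ _ h1 _ (hlt v hv) h)
    · have hd := hC2 _ (hUQ u (hT hu)) _ (hUQ v (hT hv)) ((hr u v huv').1 huv)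
      exact Finset.disjoint_left.1 hd (he1 _ _ (hlt u hu)) (h ▸ he1 _ _ (hlt v hv))

/-- In a graph that is connected and anticonnected, the union of two proper homogeneous sets that
meet is again a proper homogeneous set. -/
theorem IsHomogeneousSet.union {G : SimpleGraph V}
    (hconn : ∀ A : Set V, A.Nonempty → A ≠ Set.univ → ∃ a ∈ A, ∃ b ∉ A, G.Adj a b)
    (hanti : ∀ A : Set V, A.Nonempty → A ≠ Set.univ → ∃ a ∈ A, ∃ b ∉ A, ¬ G.Adj a b)
    {X Y : Set V} (hX : IsHomogeneousSet G X) (hY : IsHomogeneousSet G Y)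
    (hX' : X ≠ Set.univ) (hY' : Y ≠ Set.univ) {x : V} (hxX : x ∈ X) (hxY : x ∈ Y) :
    IsHomogeneousSet G (X ∪ Y) ∧ X ∪ Y ≠ Set.univ := by
  constructor
  · intro v hv
    simp only [Set.mem_union, not_or] at hv
    rcases hX v hv.1 with h1 | h1 <;> rcases hY v hv.2 with h2 | h2
    · exact Or.inl fun y hy => hy.elim (h1 y) (h2 y)
    · exact absurd (h1 x hxX) (h2 x hxY)
    · exact absurd (h2 x hxY) (h1 x hxX)
    · exact Or.inr fun y hy => hy.elim (h1 y) (h2 y)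
  · intro hU
    have hcover : ∀ v, v ∉ Y → v ∈ X := fun v hv =>
      ((Set.ext_iff.1 hU v).2 trivial).resolve_right hv
    have hne : (Yᶜ).Nonempty := Set.nonempty_compl.2 hY'
    have hne' : Yᶜ ≠ Set.univ := fun h => (h.symm ▸ Set.mem_univ x : x ∈ Yᶜ) hxY
    obtain ⟨a, ha, b, hb, hab⟩ := hconn _ hne hne'
    obtain ⟨a', ha', b', hb', hab'⟩ := hanti _ hne hne'
    rw [Set.notMem_compl_iff] at hb hb'
    obtain ⟨z, hz⟩ := Set.nonempty_compl.2 hX'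
    have hzY : z ∈ Y := by_contra fun h => hz (hcover z h)
    have h1 : G.Adj a z := by
      rcases hY a ha with h | h
      · exact h z hzY
      · exact absurd hab (h b hb)
    have h2 : ¬ G.Adj a' z := by
      rcases hY a' ha' with h | h
      · exact absurd (h b' hb') hab'
      · exact h z hzY
    rcases hX z hz with h | h
    · exact h2 (h a' (hcover a' ha')).symm
    · exact h a (hcover a ha) h1.symm

/-- A connected and anticonnected graph with at least two vertices is partitioned into its maximal
proper homogeneous sets; `r` sends each vertex to a representative of its part. -/
theorem exists_homogeneous_partition [Finite V] [Nontrivial V] {G : SimpleGraph V}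
    (hconn : ∀ A : Set V, A.Nonempty → A ≠ Set.univ → ∃ a ∈ A, ∃ b ∉ A, G.Adj a b)
    (hanti : ∀ A : Set V, A.Nonempty → A ≠ Set.univ → ∃ a ∈ A, ∃ b ∉ A, ¬ G.Adj a b) :
    ∃ r : V → V, (∀ v, r (r v) = r v) ∧
      (∀ u v, r u ≠ r v → (G.Adj u v ↔ G.Adj (r u) (r v))) ∧
      (∀ X : Set V, X ≠ Set.univ → IsHomogeneousSet G X → ∀ u ∈ X, ∀ v ∈ X, r u = r v) ∧
      ∀ i, r i = i → IsHomogeneousSet G {v | r v = i} ∧ {v | r v = i} ≠ Set.univ := by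
  have hM : ∀ v : V, ∃ M : Set V, v ∈ M ∧
      Maximal (fun X => IsHomogeneousSet G X ∧ X ≠ Set.univ) M := by
    intro v
    obtain ⟨M, h1, h2⟩ := Finite.exists_le_maximal
      (p := fun X : Set V => IsHomogeneousSet G X ∧ X ≠ Set.univ) (a := {v}) (by
        refine ⟨fun u _ => ?_, fun h => ?_⟩
        · by_cases huv : G.Adj u v
          · exact Or.inl (by rintro x rfl; exact huv)
          · exact Or.inr (by rintro x rfl; exact huv)
        · obtain ⟨u, hu⟩ := exists_ne v
          exact hu (h.symm ▸ Set.mem_univ u : u ∈ ({v} : Set V)))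
    exact ⟨M, h1 rfl, h2⟩
  choose M hvM hMmax using hM
  have hsub : ∀ X : Set V, X ≠ Set.univ → IsHomogeneousSet G X → ∀ u ∈ X, X ⊆ M u := by
    intro X hX hX' u hu
    have h := IsHomogeneousSet.union hconn hanti (hMmax u).prop.1 hX' (hMmax u).prop.2 hX
      (hvM u) hu
    exact Set.subset_union_right.trans ((hMmax u).le_of_ge h Set.subset_union_left)
  have hMeq : ∀ u v, u ∈ M v → M u = M v := by
    intro u v huv
    have h := hsub _ (hMmax v).prop.2 (hMmax v).prop.1 u huv
    exact Set.Subset.antisymm ((hMmax v).le_of_ge (hMmax u).prop h) h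
  choose! rep hrep using fun (S : Set V) (hS : S.Nonempty) => hS
  have hr : ∀ v, rep (M v) ∈ M v := fun v => hrep _ ⟨v, hvM v⟩
  have hMr : ∀ v, M (rep (M v)) = M v := fun v => hMeq _ _ (hr v)
  have hhom : ∀ u v v', u ∉ M v → v' ∈ M v → (G.Adj u v ↔ G.Adj u v') := by
    intro u v v' hu hv'
    rcases (hMmax v).prop.1 u hu with h | h
    · exact iff_of_true (h _ (hvM v)) (h _ hv')
    · exact iff_of_false (h _ (hvM v)) (h _ hv')
  refine ⟨fun v => rep (M v), fun v => by simp only [hMr], fun u v huv => ?_, ?_, ?_⟩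
  · have hne : M u ≠ M v := fun h => huv (by simp only [h])
    rw [hhom u v _ (fun h => hne (hMeq _ _ h)) (hr v), G.adj_comm,
      hhom _ u _ (fun h => hne ((hMeq _ _ h).symm.trans (hMr v))) (hr u), G.adj_comm]
  · intro X hX hX' u hu v hv
    simp only [hMeq v u (hsub X hX hX' u hu hv)]
  · intro i hi
    have : {v | rep (M v) = i} = M i := by
      ext v
      refine ⟨fun h => ?_, fun h => ?_⟩
      · have h' : rep (M v) = i := h
        rw [← h', hMr]
        exact hvM v
      · change rep (M v) = i
        rw [hMeq v i h]
        exact hi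
    rw [this]
    exact (hMmax i).prop

theorem Narrow.sum_rpow_le [Fintype V] {G : SimpleGraph V} {X : Finset V} {α : ℝ} (hα : 0 < α)
    (hX : Narrow (G.induce (X : Set V)) α) {g : V → ℝ} (hg : ∀ v, 0 ≤ g v) {t : ℝ}
    (ht : ∀ S ⊆ X, PerfectOn G S → ∑ v ∈ S, g v ≤ t) :
    ∑ v ∈ X, g v ^ α ≤ t ^ α := by
  have ht0 : 0 ≤ t := by
    simpa using ht ∅ (Finset.empty_subset _) (fun T hT k _ => ⟨fun _ => 0, by
      simp [Finset.subset_empty.1 hT]⟩)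
  have hle : ∀ v ∈ X, g v ≤ t := fun v hv => by
    simpa using ht {v} (by simpa using hv) (perfectOn_singleton G v)
  rcases ht0.eq_or_lt with h0 | h0
  · subst h0
    rw [Real.zero_rpow hα.ne']
    refine (Finset.sum_eq_zero fun v hv => ?_).le
    rw [le_antisymm (hle v hv) (hg v), Real.zero_rpow hα.ne']
  · have := hX (fun v => g v / t) ⟨fun v => div_nonneg (hg v) ht0, fun S hS => by
      rw [← Finset.sum_div, div_le_one h0]
      have h1 := (isPerfect_induce_iff_perfectOn.1 hS).map (SimpleGraph.Embedding.induce _)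
      have h2 := ht _ (fun v hv => by
        obtain ⟨a, -, rfl⟩ := Finset.mem_map.1 hv
        exact a.2) h1
      rw [Finset.sum_map] at h2
      exact h2⟩
    have h2 : ∑ v : (X : Set V), (g v / t) ^ α = ∑ v ∈ X, (g v / t) ^ α :=
      Finset.sum_coe_sort X (fun v => (g v / t) ^ α)
    rw [h2, Finset.sum_congr rfl (fun v _ => Real.div_rpow (hg v) ht0 α), ← Finset.sum_div,
      div_le_one (Real.rpow_pos_of_pos h0 α)] at this
    exact this

theorem setSum_eq_sum_subtype [Fintype V] (f : V → ℝ) (X : Set V) [Fintype X] :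
    setSum f X = ∑ v : X, f v := by
  classical
  rw [setSum, Finset.sum_indicator_eq_sum_filter]
  exact Finset.sum_subtype _ (by simp) f

theorem sum_le_setSum [Fintype V] {f : V → ℝ} (hf : ∀ v, 0 ≤ f v) {A : Finset V} {X : Set V}
    (h : ∀ v ∈ A, v ∈ X) : ∑ v ∈ A, f v ≤ setSum f X := by
  rw [setSum, Finset.sum_congr rfl (fun v hv => (Set.indicator_of_mem (h v hv) f).symm)]
  exact Finset.sum_le_univ_sum_of_nonneg fun v => Set.indicator_nonneg (fun v _ => hf v) v

theorem rpow_sub_mul_le {α α' d h x : ℝ} (hα' : 0 < α') (hαα' : α' ≤ α) (hx : 0 ≤ x)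
    (hh : 0 ≤ h) (hxd : x ≤ d) (hxh : x ≤ h ^ α) : x ≤ d ^ (1 - α' / α) * h ^ α' := by
  have hα : 0 < α := hα'.trans_le hαα'
  have h1 : 0 ≤ 1 - α' / α := sub_nonneg.2 ((div_le_one hα).2 hαα')
  have h2 : 0 < α' / α := div_pos hα' hα
  calc x = x ^ (1 - α' / α) * x ^ (α' / α) := by
        rw [← Real.rpow_add_of_nonneg hx h1 h2.le, sub_add_cancel, Real.rpow_one]
    _ ≤ d ^ (1 - α' / α) * (h ^ α) ^ (α' / α) := by
        have := Real.rpow_nonneg (hx.trans hxd) (1 - α' / α)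
        gcongr
    _ = d ^ (1 - α' / α) * h ^ α' := by
        rw [← Real.rpow_mul hh, mul_div_cancel₀ _ hα.ne']

/-- The representatives of a partition into homogeneous sets induce a forcer-free graph, if every
proper homogeneous set lies in a part and the graph is guarded. -/
theorem Guarded.forcerFree_induce {G : SimpleGraph V} (hG : Guarded G) (r : V → V)
    (hr : ∀ X : Set V, X ≠ Set.univ → IsHomogeneousSet G X → ∀ u ∈ X, ∀ v ∈ X, r u = r v) :
    ForcerFree (G.induce {v | r v = v}) := by
  refine ⟨fun f => ?_⟩
  obtain ⟨X, hX, hX', hf⟩ := hG (f.trans (SimpleGraph.Embedding.induce _))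
  have key : ∀ i j : Fin 8, i ≠ j → ((f i : V) ∈ X) → ((f j : V) ∈ X) → False := by
    intro i j hij hi hj
    have h := hr X hX hX' _ hi _ hj
    rw [(f i).2, (f j).2] at h
    exact hij (f.injective (Subtype.ext h))
  rcases hf with h | h
  · exact key 0 1 (by decide) (h 0 (by decide)) (h 1 (by decide))
  · exact key 4 5 (by decide) (h 4 (by decide)) (h 5 (by decide))

theorem sum_rpow_le_of_forcerFree_quotient {α' α : ℝ} (hα' : 0 < α') (hαα' : α' ≤ α)
    [Fintype V] {G : SimpleGraph V} (r : V → V) [Fintype {v | r v = v}]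
    (hrr : ∀ v, r (r v) = r v)
    (hr : ∀ u v, r u ≠ r v → (G.Adj u v ↔ G.Adj (r u) (r v)))
    (hnarrow' : Narrow (G.induce {v | r v = v}) α') {g : V → ℝ} (hg : GoodOn G g)
    (hnarrow : ∀ X : Finset V, X ≠ Finset.univ → ∀ t : ℝ,
      (∀ S ⊆ X, PerfectOn G S → ∑ v ∈ S, g v ≤ t) → ∑ v ∈ X, g v ^ α ≤ t ^ α)
    (hfib : ∀ i, r i = i → {v | r v = i} ≠ Set.univ) {d : ℝ} (hd0 : 0 ≤ d)
    (hd : ∀ i, r i = i → ∀ X : Finset V, (∀ v ∈ X, r v = i) → ∑ v ∈ X, g v ^ α ≤ d) :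
    ∑ v, g v ^ α ≤ d ^ (1 - α' / α) := by
  classical
  obtain ⟨hg0, hg1⟩ := hg
  have hmax : ∀ i : V, ∃ P : Finset V, (∀ v ∈ P, r v = i) ∧ PerfectOn G P ∧
      ∀ S : Finset V, (∀ v ∈ S, r v = i) → PerfectOn G S → ∑ v ∈ S, g v ≤ ∑ v ∈ P, g v := by
    intro i
    obtain ⟨P, hP, hPmax⟩ := Finset.exists_max_image
      (Finset.univ.filter (fun P : Finset V => (∀ v ∈ P, r v = i) ∧ PerfectOn G P))
      (fun P => ∑ v ∈ P, g v) ⟨∅, by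
        refine Finset.mem_filter.2 ⟨Finset.mem_univ _, by simp, fun T hT k _ => ⟨fun _ => 0, ?_⟩⟩
        simp [Finset.subset_empty.1 hT]⟩
    simp only [Finset.mem_filter, Finset.mem_univ, true_and] at hP hPmax
    exact ⟨P, hP.1, hP.2, fun S h1 h2 => hPmax S ⟨h1, h2⟩⟩
  choose P hPr hP hPmax using hmax
  have hh0 : ∀ i, 0 ≤ ∑ v ∈ P i, g v := fun i => Finset.sum_nonneg fun v _ => hg0 v
  have hsum := hnarrow' (fun i => ∑ v ∈ P i, g v) ⟨fun i => hh0 i, fun S hS => by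
    have hQ := (isPerfect_induce_iff_perfectOn.1 hS).map (SimpleGraph.Embedding.induce _)
    have hU := hQ.substitution r hr
      (U := (S.map (SimpleGraph.Embedding.induce (G := G) {v | r v = v}).toEmbedding).biUnion P)
      (fun u hu => by
        obtain ⟨i, hi, hui⟩ := Finset.mem_biUnion.1 hu
        rw [hPr i u hui]
        exact hi) (fun i _ => (hP i).mono fun v hv => by
        obtain ⟨h1, h2⟩ := Finset.mem_filter.1 hv
        obtain ⟨j, -, hvj⟩ := Finset.mem_biUnion.1 h1
        rwa [← h2, hPr j v hvj])
    have h := hg1 _ (isPerfect_induce_iff_perfectOn.2 hU)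
    rw [Finset.sum_biUnion, Finset.sum_map] at h
    · exact h
    · intro i _ j _ hij
      exact Finset.disjoint_left.2 fun x hx hy => hij ((hPr i x hx).symm.trans (hPr j x hy))⟩
  calc ∑ v, g v ^ α
      = ∑ i ∈ Finset.univ.filter (fun i => r i = i),
          ∑ v ∈ Finset.univ.filter (fun v => r v = i), g v ^ α :=
        (Finset.sum_fiberwise_of_maps_to (fun v _ => by simp [hrr]) _).symm
    _ ≤ ∑ i ∈ Finset.univ.filter (fun i => r i = i),
          d ^ (1 - α' / α) * (∑ v ∈ P i, g v) ^ α' := by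
        refine Finset.sum_le_sum fun i hi => ?_
        have hi' : r i = i := (Finset.mem_filter.1 hi).2
        refine rpow_sub_mul_le hα' hαα'
          (Finset.sum_nonneg fun v _ => Real.rpow_nonneg (hg0 v) _) (hh0 i)
          (hd i hi' _ (by simp)) (hnarrow _ (fun h => hfib i hi' ?_) _ (fun S hS hS' =>
            hPmax i S (fun v hv => (Finset.mem_filter.1 (hS hv)).2) hS'))
        ext v
        simpa using Finset.ext_iff.1 h v
    _ = d ^ (1 - α' / α) * ∑ i : {v | r v = v}, (∑ v ∈ P i, g v) ^ α' := by
        rw [← Finset.mul_sum]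
        congr 1
        exact Finset.sum_subtype _ (by simp) (fun i => (∑ v ∈ P i, g v) ^ α')
    _ ≤ d ^ (1 - α' / α) * 1 := by
        refine mul_le_mul_of_nonneg_left ?_ (Real.rpow_nonneg hd0 _)
        convert hsum
    _ = d ^ (1 - α' / α) := mul_one _

theorem Guarded.sum_rpow_le {W : Type} {α' α : ℝ} (hα' : 0 < α') (hαα' : α' ≤ α)
    (hforcer : ∀ (W : Type) [Fintype W] (H : SimpleGraph W), ForcerFree H → Narrow H α')
    [Fintype W] [Nontrivial W] {G : SimpleGraph W} (hG : Guarded G) (hconn : G.Connected)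
    {g : W → ℝ} (hg : GoodOn G g)
    (hnarrow : ∀ X : Finset W, X ≠ Finset.univ → ∀ t : ℝ,
      (∀ S ⊆ X, PerfectOn G S → ∑ v ∈ S, g v ≤ t) → ∑ v ∈ X, g v ^ α ≤ t ^ α)
    {d : ℝ} (hd : ∀ v, setSum (fun u => g u ^ α) (G.neighborSet v) ≤ d) :
    ∑ v, g v ^ α ≤ max (2 * d) (d ^ (1 - α' / α)) := by
  classical
  have hf : ∀ v, 0 ≤ g v ^ α := fun v => Real.rpow_nonneg (hg.1 v) _
  have hdX : ∀ (v : W) (X : Finset W), (∀ u ∈ X, G.Adj v u) → ∑ u ∈ X, g u ^ α ≤ d :=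
    fun v X hX => (sum_le_setSum hf hX).trans (hd v)
  have hd0 : 0 ≤ d := by
    obtain ⟨v⟩ := hconn.nonempty
    simpa using hdX v ∅ (by simp)
  have hconn' : ∀ A : Set W, A.Nonempty → A ≠ Set.univ → ∃ a ∈ A, ∃ b ∉ A, G.Adj a b := by
    rintro A ⟨a, ha⟩ hA
    obtain ⟨b, hb⟩ := (Set.ne_univ_iff_exists_notMem A).1 hA
    obtain ⟨p⟩ := hconn.preconnected a b
    obtain ⟨e, -, h1, h2⟩ := p.exists_boundary_dart A ha hb
    exact ⟨_, h1, _, h2, e.adj⟩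
  by_cases hanti : ∀ A : Set W, A.Nonempty → A ≠ Set.univ → ∃ a ∈ A, ∃ b ∉ A, ¬ G.Adj a b
  · refine le_max_of_le_right ?_
    obtain ⟨r, hrr, hr, hrX, hfib⟩ := exists_homogeneous_partition hconn' hanti
    refine sum_rpow_le_of_forcerFree_quotient hα' hαα' r hrr hr
      (hforcer _ _ (hG.forcerFree_induce r hrX)) hg hnarrow (fun i hi => (hfib i hi).2) hd0
      (fun i hi X hX => ?_)
    obtain ⟨a, ha, b, hb, hab⟩ := hconn' {v | r v = i} ⟨i, hi⟩ (hfib i hi).2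
    refine hdX b X fun u hu => ?_
    rcases (hfib i hi).1 b hb with h | h
    · exact h u (hX u hu)
    · exact absurd hab.symm (h a ha)
  · refine le_max_of_le_left ?_
    push Not at hanti
    obtain ⟨A, ⟨a, ha⟩, hA, hAc⟩ := hanti
    obtain ⟨b, hb⟩ := (Set.ne_univ_iff_exists_notMem A).1 hA
    have h1 := hdX b (Finset.univ.filter (· ∈ A)) (fun u hu =>
      (hAc u (Finset.mem_filter.1 hu).2 b hb).symm)
    have h2 := hdX a (Finset.univ.filter (· ∉ A)) (fun u hu =>
      hAc a ha u (Finset.mem_filter.1 hu).2)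
    rw [← Finset.sum_filter_add_sum_filter_not Finset.univ (· ∈ A)]
    linarith

theorem statement_19 (α' α : ℝ) (hα' : 1 ≤ α')
    (hforcer : ∀ (W : Type) [Fintype W] (H : SimpleGraph W), ForcerFree H → Narrow H α')
    (hαα' : α' ≤ α)
    {V : Type} [Fintype V] (G : SimpleGraph V)
    (hproper : ∀ S : Finset V, S ≠ Finset.univ → Narrow (G.induce (S : Set V)) α)
    (g : V → ℝ) (hg : GoodOn G g)
    (Z : Set V) (hZ : 1 < Z.ncard) (hZconn : ConnSet G Z)
    (hZguard : Guarded (G.induce Z)) (d : ℝ)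
    (hd : IsGreatest {x : ℝ | ∃ v ∈ Z, x = setSum (fun u => g u ^ α) (G.neighborSet v ∩ Z)} d) :
    setSum (fun v => g v ^ α) Z ≤ max (2 * d) (d ^ (1 - α' / α)) := by
  classical
  have hα'0 : 0 < α' := one_pos.trans_le hα'
  have hα0 : 0 < α := hα'0.trans_le hαα'
  have hnt : Nontrivial Z := by
    obtain ⟨a, b, ha, hb, hab⟩ := (Set.one_lt_ncard_iff (Set.toFinite Z)).1 hZ
    exact ⟨⟨a, ha⟩, ⟨b, hb⟩, fun h => hab (Subtype.ext_iff.1 h)⟩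
  rw [setSum_eq_sum_subtype]
  refine hZguard.sum_rpow_le hα'0 hαα' hforcer hZconn (g := fun v : Z => g v)
    ⟨fun v => hg.1 v, fun S hS => ?_⟩ (fun X hX t ht => ?_) (fun v => ?_)
  · have h := hg.2 _ (isPerfect_induce_iff_perfectOn.2
      ((isPerfect_induce_iff_perfectOn.1 hS).map (SimpleGraph.Embedding.induce _)))
    rw [Finset.sum_map] at h
    exact h
  · have hne : X.map (SimpleGraph.Embedding.induce (G := G) Z).toEmbedding ≠ Finset.univ := by
      intro h
      refine hX (Finset.eq_univ_iff_forall.2 fun v => ?_)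
      obtain ⟨u, hu, huv⟩ := Finset.mem_map.1 (Finset.eq_univ_iff_forall.1 h v)
      rwa [← Subtype.ext (a1 := u) (a2 := v) huv]
    have h := (hproper _ hne).sum_rpow_le hα0 hg.1 (t := t) (fun S hS hS' => by
      obtain ⟨S', hS'X, rfl⟩ := Finset.subset_map_iff.1 hS
      rw [Finset.sum_map]
      exact ht S' hS'X (PerfectOn.of_map _ hS'))
    rw [Finset.sum_map] at h
    exact h
  · refine le_trans (le_of_eq ?_) (hd.2 ⟨v, v.2, rfl⟩)
    have h : setSum (fun u => g u ^ α) (G.neighborSet v ∩ Z) =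
        setSum ((G.neighborSet v).indicator fun u => g u ^ α) Z := by
      simp only [setSum, Set.indicator_indicator, Set.inter_comm]
    rw [h, setSum_eq_sum_subtype _ Z]
    rfl

end EHhat
end
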